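/- Let S = R ∪ B be a bicolored point set in general position with |R| = |B| + 1 = n + 1 ≥ 2, let r be a red point on the boundary of CH(S), and suppose there is a red point r' ≠ r on the boundary of CH(S). Then there exists a 1-plane Hamiltonian alternating path on S with endpoints r and r' having at most n − b(S) crossings. -/

import Mathlib

open scoped Classical

noncomputable section

/-- Points of the plane. -/
abbrev Pt := ℝ × ℝ

/-- Orientation determinant of the ordered triple `(a, b, c)`. -/
def det2 (a b c : Pt) : ℝ :=
  (b.1 - a.1) * (c.2 - a.2) - (b.2 - a.2) * (c.1 - a.1)

/-- Two closed segments cross: some point lies in the relative interior of both. -/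
def SegCross (e f : Pt × Pt) : Prop :=
  ∃ x : Pt, x ∈ openSegment ℝ e.1 e.2 ∧ x ∈ openSegment ℝ f.1 f.2

/-- Number of crossings (unordered pairs of crossing edges) among a list of edges. -/
def crossNum (es : List (Pt × Pt)) : ℕ :=
  ((Finset.range es.length ×ˢ Finset.range es.length).filter
    (fun ij => ij.1 < ij.2 ∧
      SegCross (es.getD ij.1 ((0, 0), (0, 0))) (es.getD ij.2 ((0, 0), (0, 0))))).card

/-- Number of other edges crossing the `i`-th edge of the list. -/
def edgeCrossCount (es : List (Pt × Pt)) (i : ℕ) : ℕ :=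
  ((Finset.range es.length).filter (fun j => j ≠ i ∧
      SegCross (es.getD i ((0, 0), (0, 0))) (es.getD j ((0, 0), (0, 0))))).card

/-- Every edge is crossed by at most one other edge. -/
def OnePlane (es : List (Pt × Pt)) : Prop :=
  ∀ i ∈ Finset.range es.length, edgeCrossCount es i ≤ 1

/-- The edges of a path given by its list of vertices. -/
def pathEdges (l : List Pt) : List (Pt × Pt) := l.zip l.tail

/-- The edges of a cycle given by its list of vertices (including the wrap-around edge). -/
def cycleEdges (l : List Pt) : List (Pt × Pt) := l.zip (l.rotate 1)

/-- An edge joining a point of `R` to a point of `B`. -/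
def Bichromatic (R B : Finset Pt) (e : Pt × Pt) : Prop :=
  (e.1 ∈ R ∧ e.2 ∈ B) ∨ (e.1 ∈ B ∧ e.2 ∈ R)

/-- A Hamiltonian alternating path on the bicolored point set `R ∪ B`
with endpoints `p` and `q`. -/
structure HamAltPath (R B : Finset Pt) (p q : Pt) where
  verts : List Pt
  nodup : verts.Nodup
  cover : verts.toFinset = R ∪ B
  head_eq : verts.head? = some p
  last_eq : verts.getLast? = some q
  alt : ∀ e ∈ pathEdges verts, Bichromatic R B e

/-- A Hamiltonian alternating cycle on the bicolored point set `R ∪ B`. -/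
structure HamAltCycle (R B : Finset Pt) where
  verts : List Pt
  nodup : verts.Nodup
  cover : verts.toFinset = R ∪ B
  alt : ∀ e ∈ cycleEdges verts, Bichromatic R B e

/-- A Hamiltonian alternating path with prescribed endpoints is optimum if it has the
minimum number of crossings among all such paths. -/
def OptimumPath (R B : Finset Pt) (p q : Pt) (P : HamAltPath R B p q) : Prop :=
  ∀ Q : HamAltPath R B p q, crossNum (pathEdges P.verts) ≤ crossNum (pathEdges Q.verts)

/-- No three points of `S` are collinear. -/
def GeneralPosition (S : Finset Pt) : Prop :=
  ∀ p ∈ S, ∀ q ∈ S, ∀ r ∈ S, p ≠ q → p ≠ r → q ≠ r → ¬ Collinear ℝ ({p, q, r} : Set Pt)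

/-- Every point of `S` is a vertex (extreme point) of its convex hull. -/
def ConvexPosition (S : Finset Pt) : Prop :=
  ∀ p ∈ S, p ∉ convexHull ℝ ((S.erase p : Finset Pt) : Set Pt)

/-- The points of `S` lying on the boundary of the convex hull of `S`
(i.e. the extreme points of `S`). -/
def hullPts (S : Finset Pt) : Finset Pt :=
  S.filter fun p => p ∉ convexHull ℝ ((S.erase p : Finset Pt) : Set Pt)

/-- Cyclic successor on `Fin m`. -/
def cycSucc {m : ℕ} (hm : 0 < m) (i : Fin m) : Fin m :=
  ⟨(i.val + 1) % m, Nat.mod_lt _ hm⟩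

/-- Cyclic predecessor on `Fin m`. -/
def cycPred {m : ℕ} (hm : 0 < m) (i : Fin m) : Fin m :=
  ⟨(i.val + (m - 1)) % m, Nat.mod_lt _ hm⟩

/-- `pt` lists points in convex position, in clockwise circular order:
every index-increasing triple is clockwise oriented. -/
def CWList {m : ℕ} (pt : Fin m → Pt) : Prop :=
  Function.Injective pt ∧
    ∀ i j k : Fin m, i < j → j < k → det2 (pt i) (pt j) (pt k) < 0

/-- `pt` is a clockwise listing of the points of `S` on the boundary of `CH(S)`. -/
def IsHullList (S : Finset Pt) {m : ℕ} (pt : Fin m → Pt) : Prop :=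
  CWList pt ∧ Finset.univ.image pt = hullPts S

/-- The number of runs of color `A` (with other color `C`) in the cyclic sequence `pt`:
a run starts at an `A`-point whose cyclic predecessor is a `C`-point; a completely
`A`-colored cycle forms a single run. -/
def runCount {m : ℕ} (hm : 0 < m) (A C : Finset Pt) (pt : Fin m → Pt) : ℕ :=
  if ∀ i : Fin m, pt i ∈ A then 1
  else (Finset.univ.filter fun i : Fin m => pt i ∈ A ∧ pt (cycPred hm i) ∈ C).card

/-- `q` is the counterclockwise radial order of the points of `T` around `r`. -/
def CCWOrder (r : Pt) {k : ℕ} (q : Fin k → Pt) (T : Finset Pt) : Prop :=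
  Function.Injective q ∧ Finset.univ.image q = T ∧
    ∀ i j : Fin k, i < j → 0 < det2 r (q i) (q j)

/-- `q` is the clockwise radial order of the points of `T` around `r`. -/
def CWOrder (r : Pt) {k : ℕ} (q : Fin k → Pt) (T : Finset Pt) : Prop :=
  Function.Injective q ∧ Finset.univ.image q = T ∧
    ∀ i j : Fin k, i < j → det2 r (q i) (q j) < 0

/-- Counting one extra point of color `A` (the center), the initial segment
`q 0, …, q j` contains equally many points of color `A` and of color `C`. -/
def BalancedAt (A C : Finset Pt) {k : ℕ} (q : Fin k → Pt) (j : Fin k) : Prop :=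
  1 + (Finset.univ.filter fun i : Fin k => i ≤ j ∧ q i ∈ A).card
    = (Finset.univ.filter fun i : Fin k => i ≤ j ∧ q i ∈ C).card

/-- `j` is the first balanced index of the sequence `q`. -/
def FirstBalanced (A C : Finset Pt) {k : ℕ} (q : Fin k → Pt) (j : Fin k) : Prop :=
  BalancedAt A C q j ∧ ∀ j' : Fin k, j' < j → ¬ BalancedAt A C q j'

/-- The triple `(R ∪ B, r, b)` is a special configuration (Definition 2.2):
(i) both neighbors of `r` on the hull boundary are red and both neighbors of `b` are
blue; (ii) in the counterclockwise and clockwise radial orders around `r`, the first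
balanced point is `b`; (iii) symmetrically around `b`, the first balanced point is `r`. -/
def SpecialConfig (R B : Finset Pt) (r b : Pt) : Prop :=
  r ∈ hullPts (R ∪ B) ∧ b ∈ hullPts (R ∪ B) ∧
  (∀ (m : ℕ) (hm : 0 < m) (pt : Fin m → Pt), IsHullList (R ∪ B) pt →
    ∀ i : Fin m,
      (pt i = r → pt (cycPred hm i) ∈ R ∧ pt (cycSucc hm i) ∈ R) ∧
      (pt i = b → pt (cycPred hm i) ∈ B ∧ pt (cycSucc hm i) ∈ B)) ∧
  (∀ (k : ℕ) (q : Fin k → Pt),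
      (CCWOrder r q ((R ∪ B).erase r) ∨ CWOrder r q ((R ∪ B).erase r)) →
      ∀ j : Fin k, FirstBalanced R B q j → q j = b) ∧
  (∀ (k : ℕ) (q : Fin k → Pt),
      (CCWOrder b q ((R ∪ B).erase b) ∨ CWOrder b q ((R ∪ B).erase b)) →
      ∀ j : Fin k, FirstBalanced B R q j → q j = r)

/-- The unordered pair `{a, b}` occurs as an edge of the list `es`. -/
def IsEdgeOf (es : List (Pt × Pt)) (a b : Pt) : Prop := (a, b) ∈ es ∨ (b, a) ∈ es

/-- The clockwise cyclic interval of indices from `a` to `b`, inclusive. -/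
def cycIdx {m : ℕ} (hm : 0 < m) (a b : Fin m) : Finset (Fin m) :=
  (Finset.range ((b.val + m - a.val) % m + 1)).image
    fun t => (⟨(a.val + t) % m, Nat.mod_lt _ hm⟩ : Fin m)

/-! ### Crossing counts of edge lists -/

lemma segCross_comm {e f : Pt × Pt} : SegCross e f ↔ SegCross f e :=
  ⟨fun ⟨x, h₁, h₂⟩ => ⟨x, h₂, h₁⟩, fun ⟨x, h₁, h₂⟩ => ⟨x, h₂, h₁⟩⟩

lemma segCross_swap_left {e f : Pt × Pt} : SegCross e.swap f ↔ SegCross e f := by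
  simp only [SegCross, Prod.fst_swap, Prod.snd_swap, openSegment_symm ℝ e.2 e.1]

lemma segCross_swap_right {e f : Pt × Pt} : SegCross e f.swap ↔ SegCross e f := by
  rw [segCross_comm, segCross_swap_left, segCross_comm]

lemma segCross_self (e : Pt × Pt) : SegCross e e :=
  ⟨(1 / 2 : ℝ) • e.1 + (1 / 2 : ℝ) • e.2,
    ⟨1 / 2, 1 / 2, by norm_num, by norm_num, by norm_num, rfl⟩,
    ⟨1 / 2, 1 / 2, by norm_num, by norm_num, by norm_num, rfl⟩⟩

/-- Number of edges of `es` crossing `e`; an edge of the list crosses itself. -/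
def crossDegree (e : Pt × Pt) (es : List (Pt × Pt)) : ℕ := es.countP fun f => SegCross e f

/-- Recursive form of `crossNum`. -/
def numCross : List (Pt × Pt) → ℕ
  | [] => 0
  | e :: es => crossDegree e es + numCross es

lemma crossDegree_append (e : Pt × Pt) (es fs : List (Pt × Pt)) :
    crossDegree e (es ++ fs) = crossDegree e es + crossDegree e fs := by
  simp [crossDegree]

lemma crossDegree_cons (e f : Pt × Pt) (es : List (Pt × Pt)) :
    crossDegree e (f :: es) = crossDegree e es + if SegCross e f then 1 else 0 := by
  simp [crossDegree, List.countP_cons]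

lemma crossDegree_eq_zero {e : Pt × Pt} {es : List (Pt × Pt)} (h : ∀ f ∈ es, ¬ SegCross e f) :
    crossDegree e es = 0 := by
  simpa [crossDegree, List.countP_eq_zero] using h

lemma crossDegree_eq_sum (e : Pt × Pt) (es : List (Pt × Pt)) :
    crossDegree e es = ∑ j ∈ Finset.range es.length,
      if SegCross e (es.getD j ((0, 0), (0, 0))) then 1 else 0 := by
  induction es with
  | nil => simp [crossDegree]
  | cons f es ih =>
    rw [crossDegree_cons, ih, List.length_cons, Finset.sum_range_succ']
    simp

lemma crossNum_eq_numCross (es : List (Pt × Pt)) : crossNum es = numCross es := by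
  induction es with
  | nil => simp [crossNum, numCross]
  | cons e es ih =>
    rw [numCross, ← ih, crossDegree_eq_sum, crossNum, crossNum, Finset.card_filter,
      Finset.card_filter, Finset.sum_product, Finset.sum_product, List.length_cons,
      Finset.sum_range_succ', add_comm]
    congr 1
    · rw [Finset.sum_range_succ']
      simp
    · refine Finset.sum_congr rfl fun i _ => ?_
      rw [Finset.sum_range_succ']
      simp

lemma edgeCrossCount_add_one {es : List (Pt × Pt)} {i : ℕ} (hi : i < es.length) :
    edgeCrossCount es i + 1 = crossDegree (es.getD i ((0, 0), (0, 0))) es := by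
  rw [edgeCrossCount, Finset.card_filter, crossDegree_eq_sum,
    ← Finset.add_sum_erase _ _ (Finset.mem_range.2 hi),
    ← Finset.add_sum_erase _ _ (Finset.mem_range.2 hi), if_pos (segCross_self _)]
  simp only [ne_eq, not_true_eq_false, false_and, if_false, zero_add]
  rw [add_comm]
  congr 1
  refine Finset.sum_congr rfl fun j hj => ?_
  simp [Finset.ne_of_mem_erase hj]

lemma onePlane_of_crossDegree_le {es : List (Pt × Pt)} (h : ∀ e ∈ es, crossDegree e es ≤ 2) :
    OnePlane es := by
  intro i hi
  have hi' := Finset.mem_range.1 hi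
  have h₁ := edgeCrossCount_add_one hi'
  have h₂ := h (es.getD i ((0, 0), (0, 0))) (by
    rw [List.getD_eq_getElem _ _ hi']; exact List.getElem_mem hi')
  omega

lemma crossDegree_perm {es fs : List (Pt × Pt)} (h : es.Perm fs) (e : Pt × Pt) :
    crossDegree e es = crossDegree e fs := h.countP_eq _

lemma numCross_perm {es fs : List (Pt × Pt)} (h : es.Perm fs) : numCross es = numCross fs := by
  induction h with
  | nil => rfl
  | cons e h ih => simp only [numCross, ih, crossDegree_perm h]
  | swap e f es =>
    simp only [numCross, crossDegree_cons, segCross_comm (e := f) (f := e)]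
    omega
  | trans _ _ ih₁ ih₂ => exact ih₁.trans ih₂

lemma crossDegree_map_swap (e : Pt × Pt) (es : List (Pt × Pt)) :
    crossDegree e (es.map Prod.swap) = crossDegree e es := by
  simp [crossDegree, List.countP_map, Function.comp_def, segCross_swap_right]

lemma crossDegree_swap (e : Pt × Pt) (es : List (Pt × Pt)) :
    crossDegree e.swap es = crossDegree e es := by
  simp [crossDegree, segCross_swap_left]

lemma numCross_map_swap (es : List (Pt × Pt)) : numCross (es.map Prod.swap) = numCross es := by
  induction es with
  | nil => rfl
  | cons e es ih =>
    rw [List.map_cons, numCross, numCross, ih, crossDegree_map_swap, crossDegree_swap]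

lemma numCross_append {es fs : List (Pt × Pt)} (h : ∀ e ∈ es, ∀ f ∈ fs, ¬ SegCross e f) :
    numCross (es ++ fs) = numCross es + numCross fs := by
  induction es with
  | nil => simp [numCross]
  | cons e es ih =>
    rw [List.cons_append, numCross, numCross, crossDegree_append,
      ih fun e' he' => h e' (List.mem_cons_of_mem _ he'),
      crossDegree_eq_zero (h e List.mem_cons_self)]
    omega

/-! ### Edge lists of paths -/

lemma pathEdges_cons_cons (p q : Pt) (l : List Pt) :
    pathEdges (p :: q :: l) = (p, q) :: pathEdges (q :: l) := by
  simp [pathEdges]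

lemma pathEdges_append (l₁ l₂ : List Pt) (z : Pt) :
    pathEdges (l₁ ++ z :: l₂) = pathEdges (l₁ ++ [z]) ++ pathEdges (z :: l₂) := by
  induction l₁ with
  | nil => simp [pathEdges]
  | cons p l ih =>
    cases l with
    | nil => simp [pathEdges]
    | cons q l => simpa [pathEdges_cons_cons] using ih

lemma pathEdges_reverse (l : List Pt) :
    pathEdges l.reverse = ((pathEdges l).map Prod.swap).reverse := by
  induction l with
  | nil => simp [pathEdges]
  | cons p l ih =>
    cases l with
    | nil => simp [pathEdges]
    | cons q l =>
      have h := pathEdges_append l.reverse [p] q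
      simp only [List.reverse_cons, List.append_assoc, List.cons_append, List.nil_append] at ih ⊢
      rw [h, ih, pathEdges_cons_cons]
      simp [pathEdges]

lemma mem_of_mem_pathEdges {l : List Pt} {e : Pt × Pt} (h : e ∈ pathEdges l) :
    e.1 ∈ l ∧ e.2 ∈ l := by
  have := List.of_mem_zip (a := e.1) (b := e.2) h
  exact ⟨this.1, List.mem_of_mem_tail this.2⟩

/-! ### Elementary plane geometry -/

/-- The dot product. -/
def dot (a p : Pt) : ℝ := a.1 * p.1 + a.2 * p.2

/-- Rotation by a right angle of the vector from `p` to `q`. -/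
def rot (p q : Pt) : Pt := (-(q.2 - p.2), q.1 - p.1)

lemma dot_rot_sub (p q x : Pt) : dot (rot p q) x - dot (rot p q) p = det2 p q x := by
  simp only [dot, rot, det2]; ring

lemma det2_rotate (p q x : Pt) : det2 p q x = det2 q x p := by simp only [det2]; ring

lemma det2_swap (p q x : Pt) : det2 q p x = -det2 p q x := by simp only [det2]; ring

lemma det2_swap_right (p q x : Pt) : det2 p x q = -det2 p q x := by simp only [det2]; ring

lemma dot_lt_of_mem_openSegment {a p q x : Pt} {t : ℝ} (hp : dot a p ≤ t) (hq : dot a q ≤ t)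
    (h : dot a p < t ∨ dot a q < t) (hx : x ∈ openSegment ℝ p q) : dot a x < t := by
  obtain ⟨s, s', hs, hs', hss, rfl⟩ := hx
  have e : dot a (s • p + s' • q) = s * dot a p + s' * dot a q := by
    simp only [dot, Prod.fst_add, Prod.snd_add, Prod.smul_fst, Prod.smul_snd, smul_eq_mul]; ring
  have e' : t = s * t + s' * t := by rw [← add_mul, hss, one_mul]
  rw [e, e']
  rcases h with h | h
  · exact add_lt_add_of_lt_of_le (mul_lt_mul_of_pos_left h hs) (mul_le_mul_of_nonneg_left hq hs'.le)
  · exact add_lt_add_of_le_of_lt (mul_le_mul_of_nonneg_left hp hs.le) (mul_lt_mul_of_pos_left h hs')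

lemma dot_neg (a p : Pt) : dot (-a) p = -dot a p := by
  simp only [dot, Prod.fst_neg, Prod.snd_neg]; ring

/-- Segments in opposite closed half planes, each meeting the boundary line in at most an
endpoint, do not cross. -/
lemma not_segCross_of_dot {a p q p' q' : Pt} {t : ℝ} (hp : dot a p ≤ t) (hq : dot a q ≤ t)
    (h : dot a p < t ∨ dot a q < t) (hp' : t ≤ dot a p') (hq' : t ≤ dot a q') :
    ¬ SegCross (p, q) (p', q') := by
  rintro ⟨x, hx, s, s', hs, hs', hss, rfl⟩
  have h₁ := dot_lt_of_mem_openSegment hp hq h hx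
  have e : dot a (s • p' + s' • q') = s * dot a p' + s' * dot a q' := by
    simp only [dot, Prod.fst_add, Prod.snd_add, Prod.smul_fst, Prod.smul_snd, smul_eq_mul]; ring
  have e' : t = s * t + s' * t := by rw [← add_mul, hss, one_mul]
  simp only [e] at h₁
  have := mul_le_mul_of_nonneg_left hp' hs.le
  have := mul_le_mul_of_nonneg_left hq' hs'.le
  linarith

/-- No three distinct points of `S` are collinear, in terms of determinants. -/
def GenPos (S : Finset Pt) : Prop :=
  ∀ p ∈ S, ∀ q ∈ S, ∀ r ∈ S, p ≠ q → p ≠ r → q ≠ r → det2 p q r ≠ 0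

lemma GenPos.mono {S T : Finset Pt} (h : GenPos S) (hT : T ⊆ S) : GenPos T :=
  fun p hp q hq r hr => h p (hT hp) q (hT hq) r (hT hr)

/-- `p` is the unique minimizer over `S` of some linear functional. -/
def Exposed (S : Finset Pt) (p : Pt) : Prop :=
  ∃ a : Pt, ∀ q ∈ S, q ≠ p → dot a p < dot a q

lemma Exposed.mono {S T : Finset Pt} {p : Pt} (h : Exposed S p) (hT : T ⊆ S) : Exposed T p :=
  h.imp fun _ ha q hq => ha q (hT hq)

/-! ### Alternating paths with few crossings -/

/-- There is a path on `S` from `p` to `q`, alternating for the colouring `c`, with each edge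
crossed at most once and with `k` crossings in total. -/
def PathWith (c : Pt → ℤ) (S : Finset Pt) (p q : Pt) (k : ℕ) : Prop :=
  ∃ l : List Pt, l.Nodup ∧ l.toFinset = S ∧ l.head? = some p ∧ l.getLast? = some q ∧
    (∀ e ∈ pathEdges l, c e.1 + c e.2 = 0) ∧
    (∀ e ∈ pathEdges l, crossDegree e (pathEdges l) ≤ 2) ∧ numCross (pathEdges l) = k

lemma PathWith.reverse {c : Pt → ℤ} {S : Finset Pt} {p q : Pt} {k : ℕ}
    (h : PathWith c S p q k) : PathWith c S q p k := by
  obtain ⟨l, hn, hS, hp, hq, hc, h₁, hk⟩ := h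
  have hcd : ∀ e, crossDegree e (pathEdges l.reverse) = crossDegree e (pathEdges l) := by
    intro e
    rw [pathEdges_reverse, crossDegree_perm (List.reverse_perm _), crossDegree_map_swap]
  have hmem : ∀ e ∈ pathEdges l.reverse, e.swap ∈ pathEdges l := by
    intro e he
    rw [pathEdges_reverse, List.mem_reverse, List.mem_map] at he
    obtain ⟨f, hf, rfl⟩ := he
    simpa using hf
  refine ⟨l.reverse, List.nodup_reverse.2 hn, by simpa using hS, by simpa using hq,
    by simpa using hp, fun e he => ?_, fun e he => ?_, ?_⟩
  · have := hc _ (hmem e he)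
    simp only [Prod.fst_swap, Prod.snd_swap] at this
    omega
  · rw [hcd, ← crossDegree_swap]
    exact h₁ _ (hmem e he)
  · rw [pathEdges_reverse, numCross_perm (List.reverse_perm _), numCross_map_swap, hk]

lemma PathWith.neg {c : Pt → ℤ} {S : Finset Pt} {p q : Pt} {k : ℕ}
    (h : PathWith c S p q k) : PathWith (-c) S p q k := by
  obtain ⟨l, hn, hS, hp, hq, hc, h⟩ := h
  refine ⟨l, hn, hS, hp, hq, fun e he => ?_, h⟩
  have := hc e he
  simp only [Pi.neg_apply]
  omega

lemma pathWith_pair {c : Pt → ℤ} {p q : Pt} (hne : p ≠ q) (hc : c p + c q = 0) :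
    PathWith c {p, q} p q 0 := by
  have e : pathEdges [p, q] = [(p, q)] := by simp [pathEdges]
  refine ⟨[p, q], by simpa using hne, by ext; simp, rfl, rfl, ?_, ?_, ?_⟩
  · simpa [e] using hc
  · simp [e, crossDegree, List.countP_cons]
    split <;> omega
  · simp [e, numCross, crossDegree]

/-- Gluing two paths at a point `z` that separates their remaining vertices. -/
lemma PathWith.glue {c : Pt → ℤ} {L U : Finset Pt} {p q z a : Pt} {k₁ k₂ : ℕ}
    (hL : ∀ x ∈ L, dot a x < dot a z) (hU : ∀ x ∈ U, dot a z < dot a x)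
    (h₁ : PathWith c (insert z L) p z k₁) (h₂ : PathWith c (insert z U) z q k₂) :
    PathWith c (insert z (L ∪ U)) p q (k₁ + k₂) := by
  obtain ⟨l₁, hn₁, hS₁, hp₁, hq₁, hc₁, hd₁, hk₁⟩ := h₁
  obtain ⟨l₂, hn₂, hS₂, hp₂, hq₂, hc₂, hd₂, hk₂⟩ := h₂
  obtain ⟨m₁, rfl⟩ : ∃ m, l₁ = m ++ [z] := ⟨_, (List.dropLast_append_getLast? z hq₁).symm⟩
  obtain ⟨m₂, rfl⟩ : ∃ m, l₂ = z :: m := by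
    cases l₂ with
    | nil => simp at hp₂
    | cons x m => simp at hp₂; exact ⟨m, by rw [hp₂]⟩
  have hm₁ : ∀ x ∈ m₁ ++ [z], dot a x ≤ dot a z := by
    intro x hx
    have : x ∈ insert z L := hS₁ ▸ List.mem_toFinset.2 hx
    rcases Finset.mem_insert.1 this with rfl | h
    · exact le_rfl
    · exact (hL x h).le
  have hm₂ : ∀ x ∈ z :: m₂, dot a z ≤ dot a x := by
    intro x hx
    have : x ∈ insert z U := hS₂ ▸ List.mem_toFinset.2 hx
    rcases Finset.mem_insert.1 this with rfl | h
    · exact le_rfl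
    · exact (hU x h).le
  have hzL : z ∉ m₁ := by
    intro h; exact (List.nodup_append.1 hn₁).2.2 z h z (by simp) rfl
  have hm₁' : ∀ x ∈ m₁, dot a x < dot a z := by
    intro x hx
    have : x ∈ insert z L := hS₁ ▸ List.mem_toFinset.2 (by simp [hx])
    rcases Finset.mem_insert.1 this with rfl | h
    · exact absurd hx hzL
    · exact hL x h
  have hzU : z ∉ m₂ := (List.nodup_cons.1 hn₂).1
  have hm₂' : ∀ x ∈ m₂, dot a z < dot a x := by
    intro x hx
    have : x ∈ insert z U := hS₂ ▸ List.mem_toFinset.2 (by simp [hx])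
    rcases Finset.mem_insert.1 this with rfl | h
    · exact absurd hx hzU
    · exact hU x h
  have hne : ∀ e ∈ pathEdges (m₁ ++ [z]), dot a e.1 < dot a z ∨ dot a e.2 < dot a z := by
    intro e he
    obtain ⟨h₁, h₂⟩ := mem_of_mem_pathEdges he
    simp only [List.mem_append, List.mem_singleton] at h₁ h₂
    rcases h₁ with h₁ | h₁
    · exact .inl (hm₁' _ h₁)
    rcases h₂ with h₂ | h₂
    · exact .inr (hm₁' _ h₂)
    have := hc₁ e he
    rw [h₁, h₂] at this
    exfalso
    have key : ∀ m : List Pt, z ∉ m → (z, z) ∉ pathEdges (m ++ [z]) := by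
      intro m
      induction m with
      | nil => simp [pathEdges]
      | cons x m ih =>
        intro hz
        have hx : z ≠ x := fun h => hz (by simp [h])
        cases m with
        | nil => simp [pathEdges, hx]
        | cons y m =>
          rw [List.cons_append, List.cons_append, pathEdges_cons_cons, List.mem_cons]
          rintro (h | h)
          · exact hx (congrArg Prod.fst h)
          · exact ih (fun h => hz (List.mem_cons_of_mem _ h)) h
    exact key m₁ hzL (by rwa [show e = (z, z) from Prod.ext h₁ h₂] at he)
  have hcross : ∀ e ∈ pathEdges (m₁ ++ [z]), ∀ f ∈ pathEdges (z :: m₂), ¬ SegCross e f := by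
    intro e he f hf
    obtain ⟨h₁, h₂⟩ := mem_of_mem_pathEdges he
    obtain ⟨h₃, h₄⟩ := mem_of_mem_pathEdges hf
    exact not_segCross_of_dot (hm₁ _ h₁) (hm₁ _ h₂) (hne e he) (hm₂ _ h₃) (hm₂ _ h₄)
  refine ⟨m₁ ++ z :: m₂, ?_, ?_, ?_, ?_, ?_, ?_, ?_⟩
  · refine List.nodup_append.2 ⟨(List.nodup_append.1 hn₁).1, hn₂, fun x hx y hy hxy => ?_⟩
    have := hm₁' x hx
    have := hm₂ y hy
    rw [hxy] at *
    linarith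
  · ext x
    have e₁ := congrArg (x ∈ ·) hS₁
    have e₂ := congrArg (x ∈ ·) hS₂
    simp only [List.mem_toFinset, List.mem_append, List.mem_cons, List.not_mem_nil, or_false,
      Finset.mem_insert, Finset.mem_union, eq_iff_iff] at e₁ e₂ ⊢
    tauto
  · cases m₁ with
    | nil => simpa using hp₁
    | cons x m => simpa using hp₁
  · rw [List.getLast?_append]
    rw [hq₂]; rfl
  · intro e he
    rw [pathEdges_append, List.mem_append] at he
    exact he.elim (hc₁ e) (hc₂ e)
  · intro e he
    rw [pathEdges_append, List.mem_append] at he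
    rw [pathEdges_append, crossDegree_append]
    rcases he with he | he
    · rw [crossDegree_eq_zero (hcross e he)]; exact hd₁ e he
    · rw [crossDegree_eq_zero fun f hf h => hcross f hf e he (segCross_comm.1 h), zero_add]
      exact hd₂ e he
  · rw [pathEdges_append, numCross_append hcross, hk₁, hk₂]

/-- Adding new first and last vertices `r` and `b`, both strictly below a line through the ends of
a path that otherwise lies on or above this line. -/
lemma PathWith.extend {c : Pt → ℤ} {Q : Finset Pt} {u v r b a : Pt} {k : ℕ} {t : ℝ}
    (h : PathWith c Q v u k) (hQ : ∀ x ∈ Q, t ≤ dot a x) (hu : dot a u ≤ t) (hv : dot a v ≤ t)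
    (hr : dot a r < t) (hb : dot a b < t) (hrb : r ≠ b) (hrv : c r + c v = 0)
    (hub : c u + c b = 0) :
    ∃ k' ≤ k + 1, PathWith c (insert r (insert b Q)) r b k' := by
  obtain ⟨l, hn, hS, hp, hq, hc, hd, hk⟩ := h
  have hmem : ∀ x ∈ l, t ≤ dot a x := fun x hx => hQ x (hS ▸ List.mem_toFinset.2 hx)
  have hrl : r ∉ l := fun h => (hmem r h).not_gt hr
  have hbl : b ∉ l := fun h => (hmem b h).not_gt hb
  have e : pathEdges (r :: (l ++ [b])) = (r, v) :: (pathEdges l ++ [(u, b)]) := by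
    obtain ⟨m, rfl⟩ : ∃ m, l = m ++ [u] := ⟨_, (List.dropLast_append_getLast? u hq).symm⟩
    have h₁ : pathEdges (m ++ [u] ++ [b]) = pathEdges (m ++ [u]) ++ [(u, b)] := by
      have := pathEdges_append m [b] u
      simpa [pathEdges] using this
    rw [← h₁]
    cases m with
    | nil => simp at hp; subst hp; simp [pathEdges]
    | cons x m => simp at hp; subst hp; simp [pathEdges_cons_cons]
  have hcr : ∀ f ∈ pathEdges l, ¬ SegCross (r, v) f := fun f hf =>
    not_segCross_of_dot hr.le hv (.inl hr) (hmem _ (mem_of_mem_pathEdges hf).1)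
      (hmem _ (mem_of_mem_pathEdges hf).2)
  have hcb : ∀ f ∈ pathEdges l, ¬ SegCross (u, b) f := fun f hf =>
    not_segCross_of_dot hu hb.le (.inr hb) (hmem _ (mem_of_mem_pathEdges hf).1)
      (hmem _ (mem_of_mem_pathEdges hf).2)
  have hle : ∀ e f : Pt × Pt, (if SegCross e f then 1 else 0) ≤ 1 := by
    intro e f; split <;> omega
  have hnum : numCross ((r, v) :: (pathEdges l ++ [(u, b)])) ≤ k + 1 := by
    rw [numCross, numCross_append, crossDegree_append, crossDegree_eq_zero hcr, hk,
      crossDegree_cons]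
    · have := hle (r, v) (u, b)
      simp only [numCross, crossDegree, List.countP_nil]
      omega
    · intro f hf g hg
      rw [List.mem_singleton.1 hg]
      exact fun h => hcb f hf (segCross_comm.1 h)
  refine ⟨_, hnum, r :: (l ++ [b]), ?_, ?_, rfl, ?_, ?_, ?_, by rw [e]⟩
  · refine List.nodup_cons.2 ⟨by simp [hrl, hrb], List.nodup_append.2 ⟨hn, by simp, ?_⟩⟩
    intro x hx y hy hxy
    simp only [List.mem_singleton] at hy
    exact hbl (by rwa [← hy, ← hxy])
  · ext x
    have e₁ := congrArg (x ∈ ·) hS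
    simp only [List.mem_toFinset, eq_iff_iff] at e₁
    simp only [List.toFinset_cons, List.toFinset_append, List.toFinset_nil, Finset.mem_insert,
      Finset.mem_union, List.mem_toFinset, Finset.notMem_empty, or_false, ← e₁]
    tauto
  · rw [← List.cons_append, List.getLast?_concat]
  · rw [e]
    intro f hf
    simp only [List.mem_cons, List.mem_append, List.not_mem_nil, or_false] at hf
    rcases hf with rfl | hf | rfl
    exacts [hrv, hc f hf, hub]
  · rw [e]
    intro f hf
    rw [crossDegree_cons, crossDegree_append, crossDegree_cons]
    simp only [List.mem_cons, List.mem_append, List.not_mem_nil, or_false] at hf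
    have h₁ := hle f (r, v)
    have h₂ := hle f (u, b)
    have h₃ : crossDegree f [] = 0 := rfl
    rcases hf with rfl | hf | rfl
    · rw [crossDegree_eq_zero hcr]; omega
    · rw [if_neg fun h => hcr f hf (segCross_comm.1 h),
        if_neg fun h => hcb f hf (segCross_comm.1 h)]
      have := hd f hf
      omega
    · rw [crossDegree_eq_zero hcb]; omega

/-! ### Weights and hull arcs -/

/-- The total weight of a coloured set. -/
def wt (c : Pt → ℤ) (S : Finset Pt) : ℤ := ∑ p ∈ S, c p

/-- `c` is a colouring with the colours `1` and `-1`. -/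
def IsCol (c : Pt → ℤ) : Prop := ∀ p, c p = 1 ∨ c p = -1

lemma IsCol.neg {c : Pt → ℤ} (hc : IsCol c) : IsCol (-c) := fun p => by
  have := hc p
  simp only [Pi.neg_apply]
  omega

lemma wt_neg (c : Pt → ℤ) (S : Finset Pt) : wt (-c) S = -wt c S := by
  simp [wt]

lemma wt_insert {c : Pt → ℤ} {S : Finset Pt} {p : Pt} (h : p ∉ S) :
    wt c (insert p S) = c p + wt c S := Finset.sum_insert h

lemma wt_union {c : Pt → ℤ} {S T : Finset Pt} (h : Disjoint S T) :
    wt c (S ∪ T) = wt c S + wt c T := Finset.sum_union h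

lemma wt_erase {c : Pt → ℤ} {S : Finset Pt} {p : Pt} (h : p ∈ S) :
    wt c (S.erase p) = wt c S - c p := by
  have := Finset.add_sum_erase S c h
  simp only [wt]; omega

lemma wt_parity {c : Pt → ℤ} (hc : IsCol c) (S : Finset Pt) : ∃ m : ℤ, wt c S + 2 * m = S.card := by
  induction S using Finset.induction_on with
  | empty => exact ⟨0, by simp [wt]⟩
  | insert p S hp ih =>
    obtain ⟨m, hm⟩ := ih
    rw [wt_insert hp, Finset.card_insert_of_notMem hp]
    rcases hc p with h | h
    · exact ⟨m, by rw [h]; push_cast; omega⟩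
    · exact ⟨m + 1, by rw [h]; push_cast; omega⟩

/-- A set of nonzero weight sign contains a point of that sign. -/
lemma exists_mem_of_wt_pos {c : Pt → ℤ} (hc : IsCol c) {S : Finset Pt} (h : 0 < wt c S) :
    ∃ p ∈ S, c p = 1 := by
  by_contra! H
  have : wt c S ≤ 0 := Finset.sum_nonpos fun p hp => by
    have := hc p; have := H p hp; omega
  omega

/-- The counterclockwise hull edges of `S` from colour `1` to colour `-1`. -/
def hullArcs (c : Pt → ℤ) (S : Finset Pt) : Finset (Pt × Pt) :=
  (S ×ˢ S).filter fun e =>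
    c e.1 = 1 ∧ c e.2 = -1 ∧ ∀ p ∈ S, p ≠ e.1 → p ≠ e.2 → 0 < det2 e.1 e.2 p

lemma mem_hullArcs {c : Pt → ℤ} {S : Finset Pt} {u v : Pt} :
    (u, v) ∈ hullArcs c S ↔ (u ∈ S ∧ v ∈ S) ∧ c u = 1 ∧ c v = -1 ∧
      ∀ p ∈ S, p ≠ u → p ≠ v → 0 < det2 u v p := by
  simp [hullArcs]

/-- There is an alternating path from `p` to `q` satisfying the crossing bound for both orders of
the two colours. -/
def Good (c : Pt → ℤ) (S : Finset Pt) (p q : Pt) : Prop :=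
  ∃ k, PathWith c S p q k ∧ 2 * (k + (hullArcs c S).card) ≤ S.card ∧
    2 * (k + (hullArcs (-c) S).card) ≤ S.card

lemma Good.reverse {c : Pt → ℤ} {S : Finset Pt} {p q : Pt} (h : Good c S p q) : Good c S q p :=
  h.imp fun _ hk => ⟨hk.1.reverse, hk.2⟩

lemma Good.neg {c : Pt → ℤ} {S : Finset Pt} {p q : Pt} (h : Good c S p q) : Good (-c) S p q :=
  h.imp fun _ hk => ⟨hk.1.neg, hk.2.2, by rw [neg_neg]; exact hk.2.1⟩

lemma good_neg_iff {c : Pt → ℤ} {S : Finset Pt} {p q : Pt} : Good (-c) S p q ↔ Good c S p q :=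
  ⟨fun h => by simpa using h.neg, Good.neg⟩

lemma card_hullArcs_pair_le (c : Pt → ℤ) (p q : Pt) : (hullArcs c {p, q}).card ≤ 1 := by
  refine Finset.card_le_one.2 ?_
  rintro ⟨u, v⟩ h ⟨u', v'⟩ h'
  obtain ⟨⟨hu, hv⟩, hcu, hcv, -⟩ := mem_hullArcs.1 h
  obtain ⟨⟨hu', hv'⟩, hcu', hcv', -⟩ := mem_hullArcs.1 h'
  simp only [Finset.mem_insert, Finset.mem_singleton] at hu hv hu' hv'
  have h₁ : ∀ x y : Pt, c x = 1 → c y = -1 → x ≠ y := by rintro x y hx hy rfl; omega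
  have := h₁ u v hcu hcv
  have := h₁ u v' hcu hcv'
  have := h₁ u' v hcu' hcv
  have := h₁ u' v' hcu' hcv'
  rw [Prod.mk.injEq]
  grind

lemma good_pair {c : Pt → ℤ} {p q : Pt} (hne : p ≠ q) (h : c p + c q = 0) :
    Good c {p, q} p q := by
  have h₁ := card_hullArcs_pair_le c p q
  have h₂ := card_hullArcs_pair_le (-c) p q
  refine ⟨0, pathWith_pair hne h, ?_, ?_⟩ <;> rw [Finset.card_pair hne] <;> omega

/-! ### Hull arcs between two directions -/

lemma dot_add_smul (α β : ℝ) (f g p : Pt) :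
    dot (α • f + β • g) p = α * dot f p + β * dot g p := by
  simp only [dot, Prod.fst_add, Prod.snd_add, Prod.smul_fst, Prod.smul_snd, smul_eq_mul]; ring

lemma det2_neg_iff_of_dot {n w u v : Pt} (h : dot n u = dot n v)
    (hnw : 0 < n.1 * w.2 - n.2 * w.1) (hw : dot w v < dot w u) (p : Pt) :
    det2 u v p < 0 ↔ dot n p < dot n u := by
  have key : ((v.1 - u.1) ^ 2 + (v.2 - u.2) ^ 2) * (dot n p - dot n u)
      = (n.2 * (v.1 - u.1) - n.1 * (v.2 - u.2)) * det2 u v p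
        + (dot n v - dot n u) * ((v.1 - u.1) * (p.1 - u.1) + (v.2 - u.2) * (p.2 - u.2)) := by
    simp only [dot, det2]; ring
  have key' : ((v.1 - u.1) ^ 2 + (v.2 - u.2) ^ 2) * (n.1 * w.2 - n.2 * w.1)
      = (n.2 * (v.1 - u.1) - n.1 * (v.2 - u.2)) * (dot w u - dot w v)
        + (dot n v - dot n u) * ((v.1 - u.1) * w.2 - (v.2 - u.2) * w.1) := by
    simp only [dot]; ring
  rw [h, sub_self, zero_mul, add_zero] at key key'
  have hd : 0 < (v.1 - u.1) ^ 2 + (v.2 - u.2) ^ 2 := by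
    rcases eq_or_ne v.1 u.1 with h₁ | h₁
    · rcases eq_or_ne v.2 u.2 with h₂ | h₂
      · rw [Prod.ext h₁ h₂] at hw; exact absurd hw (lt_irrefl _)
      · have := sub_ne_zero.2 h₂; positivity
    · have := sub_ne_zero.2 h₁; positivity
  have hm : 0 < n.2 * (v.1 - u.1) - n.1 * (v.2 - u.2) := by
    by_contra! hm
    have := mul_pos hd hnw
    nlinarith [mul_nonneg (neg_nonneg.2 hm) (sub_pos.2 hw).le]
  rw [← not_le, ← not_le, not_iff_not, ← mul_nonneg_iff_of_pos_left hm, ← key,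
    mul_nonneg_iff_of_pos_left hd, h, sub_nonneg]

open scoped Topology in
/-- Turning the direction of minimization from `f`, where a point of colour `1` is minimal, to `g`,
where a point of colour `-1` is minimal, one passes a hull arc. -/
lemma exists_hullArc {c : Pt → ℤ} (hc : IsCol c) {P : Finset Pt} (hP : GenPos P) {f g z v₀ : Pt}
    (hfg : 0 < f.1 * g.2 - f.2 * g.1) (hz : z ∈ P) (hcz : c z = 1)
    (hzm : ∀ p ∈ P, p ≠ z → dot f z < dot f p) (hv₀ : v₀ ∈ P) (hcv₀ : c v₀ = -1)
    (hvm : ∀ p ∈ P, p ≠ v₀ → dot g v₀ < dot g p) :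
    ∃ (u v : Pt) (α β : ℝ), (u, v) ∈ hullArcs c P ∧ 0 < α ∧ 0 < β ∧
      (α * dot f u + β * dot g u = α * dot f v + β * dot g v) ∧
      (∀ p ∈ P, α * dot f u + β * dot g u ≤ α * dot f p + β * dot g p) ∧
      ∀ p, α * dot f p + β * dot g p < α * dot f u + β * dot g u → det2 u v p < 0 := by
  set red := P.filter fun p => c p = 1 with hred
  set blue := P.filter fun p => c p = -1 with hblue
  set h : ℝ → Pt → ℝ := fun τ p => (1 - τ) * dot f p + τ * dot g p with hh
  set K : Set ℝ := {τ | τ ∈ Set.Icc (0 : ℝ) 1 ∧ ∃ v ∈ blue, ∀ u ∈ red, h τ v ≤ h τ u} with hK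
  have hcont : ∀ p, Continuous fun τ => h τ p := fun p => by simp only [hh]; fun_prop
  have hKc : IsCompact K := by
    have : K = Set.Icc (0 : ℝ) 1 ∩ ⋃ v ∈ blue, ⋂ u ∈ red, {τ | h τ v ≤ h τ u} := by
      ext τ; simp [hK]
    rw [this]
    refine isCompact_Icc.inter_right (Set.Finite.isClosed_biUnion blue.finite_toSet fun v _ => ?_)
    exact isClosed_biInter fun u _ => isClosed_le (hcont v) (hcont u)
  have hv₀b : v₀ ∈ blue := Finset.mem_filter.2 ⟨hv₀, hcv₀⟩
  have hzr : z ∈ red := Finset.mem_filter.2 ⟨hz, hcz⟩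
  have hne : ∀ u ∈ red, ∀ v ∈ blue, u ≠ v := by
    rintro u hu v hv rfl
    have := (Finset.mem_filter.1 hu).2
    have := (Finset.mem_filter.1 hv).2
    omega
  have h1K : (1 : ℝ) ∈ K := by
    refine ⟨by simp, v₀, hv₀b, fun u hu => ?_⟩
    have := hvm u (Finset.mem_filter.1 hu).1 (hne u hu v₀ hv₀b)
    simp only [hh]; linarith
  obtain ⟨τ, hτK, hτ⟩ := hKc.exists_isLeast ⟨1, h1K⟩
  obtain ⟨⟨hτ0, hτ1⟩, v₁, hv₁, hv₁m⟩ := hτK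
  obtain ⟨v, hv, hvmin⟩ := Finset.exists_min_image blue (h τ) ⟨v₀, hv₀b⟩
  have hvr : ∀ u ∈ red, h τ v ≤ h τ u := fun u hu => (hvmin v₁ hv₁).trans (hv₁m u hu)
  have hτpos : 0 < τ := by
    rcases hτ0.lt_or_eq with h0 | h0
    · exact h0
    · have h₁ := hvr z hzr
      have h₂ := hzm v (Finset.mem_filter.1 hv).1 (hne z hzr v hv).symm
      simp only [hh, ← h0] at h₁
      linarith
  obtain ⟨u, hu, hu0, hslope⟩ : ∃ u ∈ red, h τ u = h τ v ∧
      dot g v - dot f v < dot g u - dot f u := by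
    by_contra! H
    have hev : ∀ᶠ σ in 𝓝[<] τ, ∀ u ∈ red, h σ v ≤ h σ u := by
      rw [Filter.eventually_all_finset]
      intro u hu
      rcases (hvr u hu).lt_or_eq with hlt | heq
      · have : ∀ᶠ σ in 𝓝 τ, h σ v < h σ u :=
          (hcont v).continuousAt.eventually_lt (hcont u).continuousAt hlt
        exact (this.filter_mono nhdsWithin_le_nhds).mono fun _ h => h.le
      · have hs := H u hu heq.symm
        filter_upwards [self_mem_nhdsWithin] with σ hσ
        have hσ' : σ < τ := hσ
        simp only [hh] at heq ⊢
        nlinarith [mul_nonneg (sub_pos.2 hσ').le (sub_nonneg.2 hs)]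
    have hev' : ∀ᶠ σ in 𝓝[<] τ, 0 < σ :=
      (lt_mem_nhds hτpos).filter_mono nhdsWithin_le_nhds
    obtain ⟨σ, hσ, hσ0, hστ⟩ := (hev.and (hev'.and self_mem_nhdsWithin)).exists
    have hστ' : σ < τ := hστ
    exact (hτ ⟨⟨hσ0.le, hστ'.le.trans hτ1⟩, v, hv, hσ⟩).not_gt hστ'
  have hτlt : τ < 1 := by
    rcases hτ1.lt_or_eq with h1 | h1
    · exact h1
    · exfalso
      have h₁ := hvmin v₀ hv₀b
      have h₂ := hvm u (Finset.mem_filter.1 hu).1 (hne u hu v₀ hv₀b)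
      simp only [hh, h1] at h₁ hu0
      linarith
  have hmin : ∀ p ∈ P, h τ u ≤ h τ p := by
    intro p hp
    rw [hu0]
    rcases hc p with h₁ | h₁
    · exact hvr p (Finset.mem_filter.2 ⟨hp, h₁⟩)
    · exact hvmin p (Finset.mem_filter.2 ⟨hp, h₁⟩)
  have huP := (Finset.mem_filter.1 hu).1
  have hvP := (Finset.mem_filter.1 hv).1
  have hsign : ∀ p, det2 u v p < 0 ↔ h τ p < h τ u := by
    simp only [hh, ← dot_add_smul]
    refine det2_neg_iff_of_dot (w := g - f) ?_ ?_ ?_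
    · simpa only [dot_add_smul] using hu0
    · simp only [Prod.fst_add, Prod.snd_add, Prod.smul_fst, Prod.smul_snd, smul_eq_mul,
        Prod.fst_sub, Prod.snd_sub]
      nlinarith
    · simp only [dot, Prod.fst_sub, Prod.snd_sub] at hslope ⊢
      linarith
  refine ⟨u, v, 1 - τ, τ, mem_hullArcs.2 ⟨⟨huP, hvP⟩, (Finset.mem_filter.1 hu).2,
    (Finset.mem_filter.1 hv).2, fun p hp hpu hpv => ?_⟩, by linarith, hτpos, hu0, hmin,
    fun p => (hsign p).2⟩
  refine lt_of_le_of_ne ?_ (hP u huP v hvP p hp (hne u hu v hv) hpu.symm hpv.symm).symm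
  exact not_lt.1 fun hlt => ((hsign p).1 hlt).not_ge (hmin p hp)

/-- There is at most one hull edge crossing a given line in a given direction. -/
lemma bridge_unique {S : Finset Pt} {a x y x' y' : Pt} {t : ℝ} (hxS : x ∈ S) (hyS : y ∈ S)
    (hxS' : x' ∈ S) (hyS' : y' ∈ S) (hx : dot a x < t) (hy : t < dot a y) (hx' : dot a x' < t)
    (hy' : t < dot a y') (h : ∀ p ∈ S, p ≠ x → p ≠ y → 0 < det2 x y p)
    (h' : ∀ p ∈ S, p ≠ x' → p ≠ y' → 0 < det2 x' y' p) : x = x' ∧ y = y' := by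
  have key : (dot a y' - t) * det2 x y x' + (t - dot a x') * det2 x y y'
      + (dot a y - t) * det2 x' y' x + (t - dot a x) * det2 x' y' y = 0 := by
    simp only [dot, det2]; ring
  have hle : ∀ u v p : Pt, (p ≠ u → p ≠ v → 0 < det2 u v p) → 0 ≤ det2 u v p := by
    intro u v p hp
    by_cases h₁ : p = u
    · subst h₁; simp [det2]
    by_cases h₂ : p = v
    · subst h₂; simp only [det2]; linarith
    exact (hp h₁ h₂).le
  have h₁ := mul_nonneg (sub_pos.2 hy').le (hle x y x' (h x' hxS'))
  have h₂ := mul_nonneg (sub_pos.2 hx').le (hle x y y' (h y' hyS'))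
  have h₃ := mul_nonneg (sub_pos.2 hy).le (hle x' y' x (h' x hxS))
  have h₄ := mul_nonneg (sub_pos.2 hx).le (hle x' y' y (h' y hyS))
  constructor
  · by_contra hne
    have := mul_pos (sub_pos.2 hy') (h x' hxS' (Ne.symm hne) (by rintro rfl; linarith))
    linarith
  · by_contra hne
    have := mul_pos (sub_pos.2 hx') (h y' hyS' (by rintro rfl; linarith) (Ne.symm hne))
    linarith

/-! ### Splitting at a pivot point -/

/-- The line through `z` with normal `a` has exactly the points of `L` strictly below it and the
points of `U` strictly above it. -/
structure Separates (a z : Pt) (L U S : Finset Pt) : Prop where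
  eq : S = insert z (L ∪ U)
  low : ∀ x ∈ L, dot a x < dot a z
  high : ∀ x ∈ U, dot a z < dot a x

namespace Separates

variable {a z : Pt} {L U S : Finset Pt}

lemma symm (h : Separates a z L U S) : Separates (-a) z U L S where
  eq := by rw [h.eq, Finset.union_comm]
  low x hx := by simpa only [dot_neg, neg_lt_neg_iff] using h.high x hx
  high x hx := by simpa only [dot_neg, neg_lt_neg_iff] using h.low x hx

lemma low_subset (h : Separates a z L U S) : insert z L ⊆ S := by
  rw [h.eq]; exact Finset.insert_subset_insert _ Finset.subset_union_left

lemma high_subset (h : Separates a z L U S) : insert z U ⊆ S := by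
  rw [h.eq]; exact Finset.insert_subset_insert _ Finset.subset_union_right

lemma mem (h : Separates a z L U S) : z ∈ S := h.low_subset (Finset.mem_insert_self _ _)

lemma notMem_low (h : Separates a z L U S) : z ∉ L := fun hz => (h.low z hz).false

lemma notMem_high (h : Separates a z L U S) : z ∉ U := fun hz => (h.high z hz).false

lemma disjoint (h : Separates a z L U S) : Disjoint L U :=
  Finset.disjoint_left.2 fun x hx hx' => ((h.low x hx).trans (h.high x hx')).false

lemma card_eq (h : Separates a z L U S) : S.card = L.card + U.card + 1 := by
  rw [h.eq, Finset.card_insert_of_notMem, Finset.card_union_of_disjoint h.disjoint]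
  simp [h.notMem_low, h.notMem_high]

lemma wt_eq (h : Separates a z L U S) (c : Pt → ℤ) : wt c S = c z + wt c L + wt c U := by
  rw [h.eq, wt_insert, wt_union h.disjoint, add_assoc]
  simp [h.notMem_low, h.notMem_high]

lemma exists_extra_low {c : Pt → ℤ} (h : Separates a z L U S) (hc : IsCol c) (hS : GenPos S)
    {x y : Pt}
    (hx : x ∈ L) (hy : y ∈ U) (hcx : c x = 1) (hcz : c z = -1)
    (hxy : ∀ p ∈ S, p ≠ x → p ≠ y → 0 < det2 x y p) :
    ∃ e ∈ hullArcs c (insert z L), e ∉ hullArcs c S := by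
  have hlow : ∀ p ∈ insert z L, dot a p ≤ dot a z := by
    intro p hp
    rcases Finset.mem_insert.1 hp with rfl | hp
    exacts [le_rfl, (h.low p hp).le]
  have hyz := h.high y hy
  have hxz := h.low x hx
  have hne : ∀ p ∈ insert z L, p ≠ y := by
    rintro p hp rfl
    exact absurd (hlow p hp) hyz.not_ge
  obtain ⟨u, v, α, β, huv, hα, hβ, -, -, hneg⟩ :=
    exists_hullArc (f := rot x y) (g := -a) hc (hS.mono h.low_subset)
      (by simp only [dot, rot, Prod.fst_neg, Prod.snd_neg] at hxz hyz ⊢; nlinarith)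
      (Finset.mem_insert_of_mem hx) hcx
      (fun p hp hpx => by
        have := hxy p (h.low_subset hp) hpx (hne p hp)
        rw [← dot_rot_sub] at this
        linarith)
      (Finset.mem_insert_self z L) hcz
      (fun p hp hpz => by
        have := h.low p (Finset.mem_of_mem_insert_of_ne hp hpz)
        simpa only [dot_neg, neg_lt_neg_iff] using this)
  refine ⟨_, huv, fun huv' => ?_⟩
  obtain ⟨⟨hu, hv⟩, hcu, hcv, hpos⟩ := mem_hullArcs.1 huv'
  obtain ⟨⟨hu', hv'⟩, -, -, -⟩ := mem_hullArcs.1 huv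
  have hyS := h.high_subset (Finset.mem_insert_of_mem hy)
  refine (hpos y hyS (hne u hu').symm (hne v hv').symm).not_gt (hneg y ?_)
  have h₂ : 0 ≤ det2 x y u := by
    rcases eq_or_ne u x with rfl | hux
    · simp [det2]
    · exact (hxy u hu hux (hne u hu')).le
  have h₃ := dot_rot_sub x y y
  have h₄ := dot_rot_sub x y u
  rw [show det2 x y y = 0 by simp only [det2]; ring] at h₃
  have h₅ := hlow u hu'
  rw [dot_neg, dot_neg]
  exact add_lt_add_of_le_of_lt (mul_le_mul_of_nonneg_left (by linarith) hα.le)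
    (mul_lt_mul_of_pos_left (by linarith) hβ)

lemma exists_extra_high {c : Pt → ℤ} (h : Separates a z L U S) (hc : IsCol c) (hS : GenPos S)
    {x y : Pt} (hx : x ∈ L) (hy : y ∈ U) (hcz : c z = 1) (hcy : c y = -1)
    (hxy : ∀ p ∈ S, p ≠ x → p ≠ y → 0 < det2 x y p) :
    ∃ e ∈ hullArcs c (insert z U), e ∉ hullArcs c S := by
  have hhigh : ∀ p ∈ insert z U, dot a z ≤ dot a p := by
    intro p hp
    rcases Finset.mem_insert.1 hp with rfl | hp
    exacts [le_rfl, (h.high p hp).le]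
  have hyz := h.high y hy
  have hxz := h.low x hx
  have hne : ∀ p ∈ insert z U, p ≠ x := by
    rintro p hp rfl
    exact absurd (hhigh p hp) hxz.not_ge
  have hrot : dot (rot x y) y = dot (rot x y) x := by
    have h₃ := dot_rot_sub x y y
    rw [show det2 x y y = 0 by simp only [det2]; ring] at h₃
    linarith
  obtain ⟨u, v, α, β, huv, hα, hβ, -, -, hneg⟩ :=
    exists_hullArc (f := a) (g := rot x y) hc (hS.mono h.high_subset)
      (by simp only [dot, rot] at hxz hyz ⊢; nlinarith)
      (Finset.mem_insert_self z U) hcz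
      (fun p hp hpz => h.high p (Finset.mem_of_mem_insert_of_ne hp hpz))
      (Finset.mem_insert_of_mem hy) hcy
      (fun p hp hpy => by
        have := hxy p (h.high_subset hp) (hne p hp) hpy
        rw [← dot_rot_sub] at this
        linarith)
  refine ⟨_, huv, fun huv' => ?_⟩
  obtain ⟨⟨hu, hv⟩, hcu, hcv, hpos⟩ := mem_hullArcs.1 huv'
  obtain ⟨⟨hu', hv'⟩, -, -, -⟩ := mem_hullArcs.1 huv
  have hxS := h.low_subset (Finset.mem_insert_of_mem hx)
  refine (hpos x hxS (hne u hu').symm (hne v hv').symm).not_gt (hneg x ?_)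
  have h₂ : 0 ≤ det2 x y u := by
    rcases eq_or_ne u y with rfl | huy
    · simp only [det2]; linarith
    · exact (hxy u hu (hne u hu') huy).le
  have h₄ := dot_rot_sub x y u
  have h₅ := hhigh u hu'
  exact add_lt_add_of_lt_of_le (mul_lt_mul_of_pos_left (by linarith) hα)
    (mul_le_mul_of_nonneg_left (by linarith) hβ.le)

end Separates

/-- The hull arcs of `S` with both ends in `T`. -/
def innerArcs (c : Pt → ℤ) (S T : Finset Pt) : Finset (Pt × Pt) :=
  (hullArcs c S).filter fun e => e.1 ∈ T ∧ e.2 ∈ T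

/-- The hull arcs of `S` from `L` to `U`. -/
def bridges (c : Pt → ℤ) (S L U : Finset Pt) : Finset (Pt × Pt) :=
  (hullArcs c S).filter fun e => e.1 ∈ L ∧ e.2 ∈ U

lemma innerArcs_subset {c : Pt → ℤ} {S T : Finset Pt} (hT : T ⊆ S) :
    innerArcs c S T ⊆ hullArcs c T := by
  rintro ⟨u, v⟩ h
  obtain ⟨h, hu, hv⟩ := Finset.mem_filter.1 h
  obtain ⟨-, hcu, hcv, hpos⟩ := mem_hullArcs.1 h
  exact mem_hullArcs.2 ⟨⟨hu, hv⟩, hcu, hcv, fun p hp => hpos p (hT hp)⟩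

lemma card_innerArcs_lt {c : Pt → ℤ} {S T : Finset Pt} (hT : T ⊆ S)
    (h : ∃ e ∈ hullArcs c T, e ∉ hullArcs c S) :
    (innerArcs c S T).card + 1 ≤ (hullArcs c T).card := by
  obtain ⟨e, he, he'⟩ := h
  refine Finset.card_lt_card (Finset.ssubset_iff_subset_ne.2 ⟨innerArcs_subset hT, fun h => ?_⟩)
  rw [← h] at he
  exact he' (Finset.mem_filter.1 he).1

lemma card_innerArcs_le {c : Pt → ℤ} {S T : Finset Pt} (hT : T ⊆ S) :
    (innerArcs c S T).card ≤ (hullArcs c T).card := Finset.card_le_card (innerArcs_subset hT)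

namespace Separates

variable {a z : Pt} {L U S : Finset Pt}

lemma card_hullArcs_le (h : Separates a z L U S) (c : Pt → ℤ) :
    (hullArcs c S).card ≤ (innerArcs c S (insert z L)).card + (innerArcs c S (insert z U)).card
      + (bridges c S L U).card + (bridges c S U L).card := by
  have : hullArcs c S ⊆ innerArcs c S (insert z L) ∪ innerArcs c S (insert z U)
      ∪ bridges c S L U ∪ bridges c S U L := by
    rintro ⟨u, v⟩ he
    have huv := (mem_hullArcs.1 he).1
    rw [h.eq] at huv
    simp only [Finset.mem_insert, Finset.mem_union] at huv
    simp only [Finset.mem_union, innerArcs, bridges, Finset.mem_filter, he, true_and,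
      Finset.mem_insert]
    tauto
  refine (Finset.card_le_card this).trans ((Finset.card_union_le _ _).trans ?_)
  gcongr
  refine (Finset.card_union_le _ _).trans ?_
  gcongr
  exact Finset.card_union_le _ _

lemma bridges_le_one (h : Separates a z L U S) (c : Pt → ℤ) : (bridges c S L U).card ≤ 1 := by
  refine Finset.card_le_one.2 ?_
  rintro ⟨x, y⟩ he ⟨x', y'⟩ he'
  obtain ⟨he, hx, hy⟩ := Finset.mem_filter.1 he
  obtain ⟨he', hx', hy'⟩ := Finset.mem_filter.1 he'
  obtain ⟨⟨hxS, hyS⟩, -, -, hpos⟩ := mem_hullArcs.1 he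
  obtain ⟨⟨hxS', hyS'⟩, -, -, hpos'⟩ := mem_hullArcs.1 he'
  obtain ⟨h₁, h₂⟩ := bridge_unique hxS hyS hxS' hyS' (h.low x hx) (h.high y hy) (h.low x' hx')
    (h.high y' hy') hpos hpos'
  rw [h₁, h₂]

lemma card_low_add_bridges (h : Separates a z L U S) {c : Pt → ℤ} (hc : IsCol c) (hS : GenPos S)
    (hz : c z = -1) :
    (innerArcs c S (insert z L)).card + (bridges c S L U).card
      ≤ (hullArcs c (insert z L)).card := by
  have h₁ := h.bridges_le_one c
  rcases (bridges c S L U).eq_empty_or_nonempty with h₀ | ⟨⟨x, y⟩, he⟩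
  · rw [h₀]; exact card_innerArcs_le h.low_subset
  · obtain ⟨he, hx, hy⟩ := Finset.mem_filter.1 he
    obtain ⟨-, hcx, -, hpos⟩ := mem_hullArcs.1 he
    have := card_innerArcs_lt h.low_subset (h.exists_extra_low hc hS hx hy hcx hz hpos)
    omega

lemma card_high_add_bridges (h : Separates a z L U S) {c : Pt → ℤ} (hc : IsCol c) (hS : GenPos S)
    (hz : c z = 1) :
    (innerArcs c S (insert z U)).card + (bridges c S L U).card
      ≤ (hullArcs c (insert z U)).card := by
  have h₁ := h.bridges_le_one c
  rcases (bridges c S L U).eq_empty_or_nonempty with h₀ | ⟨⟨x, y⟩, he⟩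
  · rw [h₀]; exact card_innerArcs_le h.high_subset
  · obtain ⟨he, hx, hy⟩ := Finset.mem_filter.1 he
    obtain ⟨-, -, hcy, hpos⟩ := mem_hullArcs.1 he
    have := card_innerArcs_lt h.high_subset (h.exists_extra_high hc hS hx hy hz hcy hpos)
    omega

/-- Splitting at a point does not decrease the total number of hull arcs. -/
lemma card_hullArcs_le_add (h : Separates a z L U S) {c : Pt → ℤ} (hc : IsCol c) (hS : GenPos S) :
    (hullArcs c S).card ≤ (hullArcs c (insert z L)).card + (hullArcs c (insert z U)).card := by
  have h₀ := h.card_hullArcs_le c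
  rcases hc z with hz | hz
  · have h₁ := h.card_high_add_bridges hc hS hz
    have h₂ := h.symm.card_high_add_bridges hc hS hz
    omega
  · have h₁ := h.card_low_add_bridges hc hS hz
    have h₂ := h.symm.card_low_add_bridges hc hS hz
    omega

/-- Splitting at a point below a hull edge joining two points of the other colour strictly
increases the total number of hull arcs. -/
lemma card_hullArcs_lt_add (h : Separates a z L U S) {c : Pt → ℤ} (hc : IsCol c) (hS : GenPos S)
    {x y : Pt} (hx : x ∈ L) (hy : y ∈ U) (hxz : c x + c z = 0) (hyz : c y + c z = 0)
    (hxy : ∀ p ∈ S, p ≠ x → p ≠ y → 0 < det2 x y p) :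
    (hullArcs c S).card + 1 ≤
      (hullArcs c (insert z L)).card + (hullArcs c (insert z U)).card := by
  have h₀ := h.card_hullArcs_le c
  have hxS := h.low_subset (Finset.mem_insert_of_mem hx)
  have hyS := h.high_subset (Finset.mem_insert_of_mem hy)
  have hbr : bridges c S L U = ∅ := by
    refine Finset.eq_empty_of_forall_notMem ?_
    rintro ⟨x', y'⟩ he
    obtain ⟨he, hx', hy'⟩ := Finset.mem_filter.1 he
    obtain ⟨⟨hxS', hyS'⟩, hcx, hcy, hpos⟩ := mem_hullArcs.1 he
    obtain ⟨rfl, rfl⟩ := bridge_unique hxS hyS hxS' hyS' (h.low x hx) (h.high y hy) (h.low x' hx')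
      (h.high y' hy') hxy hpos
    omega
  rw [hbr, Finset.card_empty] at h₀
  rcases hc z with hz | hz
  · have h₁ := card_innerArcs_lt h.high_subset
      (h.exists_extra_high hc hS hx hy hz (by omega) hxy)
    have h₂ := h.symm.card_high_add_bridges hc hS hz
    omega
  · have h₁ := card_innerArcs_lt h.low_subset
      (h.exists_extra_low hc hS hx hy (by omega) hz hxy)
    have h₂ := h.symm.card_low_add_bridges hc hS hz
    omega

lemma good (h : Separates a z L U S) {c : Pt → ℤ} (hc : IsCol c) (hS : GenPos S) {p q : Pt}
    (h₁ : Good c (insert z L) p z) (h₂ : Good c (insert z U) z q) (hU : Even U.card) :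
    Good c S p q := by
  obtain ⟨k₁, hp₁, hl₁, hl₁'⟩ := h₁
  obtain ⟨k₂, hp₂, hl₂, hl₂'⟩ := h₂
  have e₁ := h.card_hullArcs_le_add hc hS
  have e₂ := h.card_hullArcs_le_add hc.neg hS
  rw [Finset.card_insert_of_notMem h.notMem_low] at hl₁ hl₁'
  rw [Finset.card_insert_of_notMem h.notMem_high] at hl₂ hl₂'
  obtain ⟨m, hm⟩ := hU
  refine ⟨k₁ + k₂, ?_, ?_, ?_⟩
  · rw [h.eq]; exact hp₁.glue h.low h.high hp₂
  · rw [h.card_eq]; omega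
  · rw [h.card_eq]; omega

lemma good_of_bridge (h : Separates a z L U S) {c : Pt → ℤ} (hc : IsCol c) (hS : GenPos S)
    {p q x y : Pt} (h₁ : Good c (insert z L) p z) (h₂ : Good c (insert z U) z q)
    (hx : x ∈ L) (hy : y ∈ U) (hxz : c x + c z = 0) (hyz : c y + c z = 0)
    (hxy : ∀ p ∈ S, p ≠ x → p ≠ y → 0 < det2 x y p) : Good c S p q := by
  obtain ⟨k₁, hp₁, hl₁, hl₁'⟩ := h₁
  obtain ⟨k₂, hp₂, hl₂, hl₂'⟩ := h₂
  have e₁ := h.card_hullArcs_lt_add hc hS hx hy hxz hyz hxy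
  have e₂ := h.card_hullArcs_lt_add hc.neg hS hx hy (by simp only [Pi.neg_apply]; omega)
    (by simp only [Pi.neg_apply]; omega) hxy
  rw [Finset.card_insert_of_notMem h.notMem_low] at hl₁ hl₁'
  rw [Finset.card_insert_of_notMem h.notMem_high] at hl₂ hl₂'
  refine ⟨k₁ + k₂, ?_, ?_, ?_⟩
  · rw [h.eq]; exact hp₁.glue h.low h.high hp₂
  · rw [h.card_eq]; omega
  · rw [h.card_eq]; omega

end Separates

/-! ### Lines through two points, slightly tilted -/

lemma exists_tilt (S : Finset Pt) (a d z : Pt) : ∃ ε > (0 : ℝ), ∀ p ∈ S,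
    (dot a p < dot a z → dot (a + ε • d) p < dot (a + ε • d) z) ∧
      (dot a z < dot a p → dot (a + ε • d) z < dot (a + ε • d) p) := by
  have key : ∀ p q : Pt, dot a p < dot a q →
      ∃ δ > (0 : ℝ), ∀ ε, 0 < ε → ε < δ → dot (a + ε • d) p < dot (a + ε • d) q := by
    intro p q hpq
    refine ⟨(dot a q - dot a p) / (|dot d p - dot d q| + 1),
      div_pos (sub_pos.2 hpq) (by positivity), fun ε hε hlt => ?_⟩
    rw [lt_div_iff₀ (by positivity)] at hlt
    have e : ∀ x, dot (a + ε • d) x = dot a x + ε * dot d x := fun x => by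
      simp only [dot, Prod.fst_add, Prod.snd_add, Prod.smul_fst, Prod.smul_snd, smul_eq_mul]; ring
    rw [e, e]
    have := mul_le_mul_of_nonneg_left (le_abs_self (dot d p - dot d q)) hε.le
    linarith
  suffices h : ∃ δ > (0 : ℝ), ∀ ε, 0 < ε → ε < δ → ∀ p ∈ S,
      (dot a p < dot a z → dot (a + ε • d) p < dot (a + ε • d) z) ∧
        (dot a z < dot a p → dot (a + ε • d) z < dot (a + ε • d) p) by
    obtain ⟨δ, hδ, h⟩ := h
    exact ⟨δ / 2, half_pos hδ, h _ (half_pos hδ) (half_lt_self hδ)⟩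
  induction S using Finset.induction_on with
  | empty => exact ⟨1, one_pos, by simp⟩
  | insert p S _ ih =>
    obtain ⟨δ, hδ, h⟩ := ih
    have h₁ : ∃ δ > (0 : ℝ), ∀ ε, 0 < ε → ε < δ →
        (dot a p < dot a z → dot (a + ε • d) p < dot (a + ε • d) z) ∧
          (dot a z < dot a p → dot (a + ε • d) z < dot (a + ε • d) p) := by
      rcases lt_trichotomy (dot a p) (dot a z) with hp | hp | hp
      · obtain ⟨δ, hδ, h⟩ := key p z hp
        exact ⟨δ, hδ, fun ε h₁ h₂ => ⟨fun _ => h ε h₁ h₂, fun h => absurd h hp.not_gt⟩⟩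
      · exact ⟨1, one_pos, fun ε _ _ => ⟨fun h => absurd h hp.not_lt, fun h => absurd h hp.not_gt⟩⟩
      · obtain ⟨δ, hδ, h⟩ := key z p hp
        exact ⟨δ, hδ, fun ε h₁ h₂ => ⟨fun h => absurd h hp.not_gt, fun _ => h ε h₁ h₂⟩⟩
    obtain ⟨δ', hδ', h'⟩ := h₁
    refine ⟨min δ δ', lt_min hδ hδ', fun ε h₁ h₂ q hq => ?_⟩
    rcases Finset.mem_insert.1 hq with rfl | hq
    · exact h' ε h₁ (h₂.trans_le (min_le_right _ _))
    · exact h ε h₁ (h₂.trans_le (min_le_left _ _)) q hq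

lemma dot_sub_lt {r z : Pt} (hne : r ≠ z) : dot (z - r) r < dot (z - r) z := by
  have : 0 < (z.1 - r.1) ^ 2 + (z.2 - r.2) ^ 2 := by
    rcases eq_or_ne z.1 r.1 with h₁ | h₁
    · rcases eq_or_ne z.2 r.2 with h₂ | h₂
      · exact absurd (Prod.ext h₁ h₂).symm hne
      · have := sub_ne_zero.2 h₂; positivity
    · have := sub_ne_zero.2 h₁; positivity
  simp only [dot, Prod.fst_sub, Prod.snd_sub]
  nlinarith

lemma dot_add_smul_right (a d p : Pt) (ε : ℝ) : dot (a + ε • d) p = dot a p + ε * dot d p := by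
  simp only [dot, Prod.fst_add, Prod.snd_add, Prod.smul_fst, Prod.smul_snd, smul_eq_mul]; ring

lemma dot_rot_right (p q : Pt) : dot (rot p q) q = dot (rot p q) p := by
  simp only [dot, rot]; ring

lemma exposed_of_edge {S : Finset Pt} {r b : Pt} (hne : r ≠ b)
    (h : ∀ p ∈ S, p ≠ r → p ≠ b → 0 < det2 r b p) : Exposed S r := by
  obtain ⟨ε, hε, hε'⟩ := exists_tilt S (rot r b) (b - r) r
  refine ⟨rot r b + ε • (b - r), fun p hp hpr => ?_⟩
  by_cases hpb : p = b
  · subst hpb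
    rw [dot_add_smul_right, dot_add_smul_right, dot_rot_right]
    have := mul_lt_mul_of_pos_left (dot_sub_lt hne) hε
    linarith
  · refine (hε' p hp).2 ?_
    have := h p hp hpr hpb
    rw [← dot_rot_sub] at this
    linarith

lemma exposed_of_edge' {S : Finset Pt} {r b : Pt} (hne : r ≠ b)
    (h : ∀ p ∈ S, p ≠ r → p ≠ b → 0 < det2 r b p) : Exposed S b := by
  obtain ⟨ε, hε, hε'⟩ := exists_tilt S (rot r b) (r - b) b
  refine ⟨rot r b + ε • (r - b), fun p hp hpb => ?_⟩
  by_cases hpr : p = r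
  · subst hpr
    rw [dot_add_smul_right, dot_add_smul_right, dot_rot_right]
    have := mul_lt_mul_of_pos_left (dot_sub_lt hne.symm) hε
    linarith
  · refine (hε' p hp).2 ?_
    have := h p hp hpr hpb
    rw [← dot_rot_sub] at this
    rw [dot_rot_right]
    linarith

lemma Separates.exposed_low {a z : Pt} {L U S : Finset Pt} (h : Separates a z L U S) :
    Exposed (insert z L) z := by
  refine ⟨-a, fun p hp hpz => ?_⟩
  have := h.low p (Finset.mem_of_mem_insert_of_ne hp hpz)
  simpa only [dot_neg, neg_lt_neg_iff] using this

lemma Separates.exposed_high {a z : Pt} {L U S : Finset Pt} (h : Separates a z L U S) :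
    Exposed (insert z U) z := h.symm.exposed_low

lemma exists_separates {S : Finset Pt} (hS : GenPos S) {r z : Pt} (hr : r ∈ S) (hz : z ∈ S)
    (hne : r ≠ z) {σ : ℝ} (hσ : σ ≠ 0) :
    ∃ a, Separates a z (insert r (S.filter fun p => σ * det2 r z p < 0))
      (S.filter fun p => 0 < σ * det2 r z p) S := by
  have hdot : ∀ p, dot (σ • rot r z) p - dot (σ • rot r z) z = σ * det2 r z p := fun p => by
    simp only [dot, rot, det2, Prod.smul_fst, Prod.smul_snd, smul_eq_mul]; ring
  obtain ⟨ε, hε, h⟩ := exists_tilt S (σ • rot r z) (z - r) z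
  refine ⟨σ • rot r z + ε • (z - r), ?_, fun x hx => ?_, fun x hx => ?_⟩
  · ext p
    simp only [Finset.mem_insert, Finset.mem_union, Finset.mem_filter]
    constructor
    · intro hp
      by_cases h₁ : p = z
      · exact .inl h₁
      by_cases h₂ : p = r
      · exact .inr (.inl (.inl h₂))
      have := mul_ne_zero hσ (hS r hr z hz p hp hne (Ne.symm h₂) (Ne.symm h₁))
      rcases lt_or_gt_of_ne this with h₃ | h₃ <;> tauto
    · rintro (rfl | (rfl | h) | h)
      exacts [hz, hr, h.1, h.1]
  · rcases Finset.mem_insert.1 hx with rfl | hx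
    · have h₁ := hdot x
      rw [show det2 x z x = 0 by simp only [det2]; ring] at h₁
      have := mul_lt_mul_of_pos_left (dot_sub_lt hne) hε
      rw [dot_add_smul_right, dot_add_smul_right]
      linarith
    · obtain ⟨hx, hneg⟩ := Finset.mem_filter.1 hx
      exact (h x hx).1 (by linarith [hdot x])
  · obtain ⟨hx, hpos⟩ := Finset.mem_filter.1 hx
    exact (h x hx).2 (by linarith [hdot x])

lemma exists_separates_pos {S : Finset Pt} (hS : GenPos S) {r z : Pt} (hr : r ∈ S) (hz : z ∈ S)
    (hne : r ≠ z) : ∃ a, Separates a z (insert r (S.filter fun p => 0 < det2 r z p))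
      (S.filter fun p => det2 r z p < 0) S := by
  simpa using exists_separates hS hr hz hne (σ := -1) (by norm_num)

lemma exists_separates_neg {S : Finset Pt} (hS : GenPos S) {r z : Pt} (hr : r ∈ S) (hz : z ∈ S)
    (hne : r ≠ z) : ∃ a, Separates a z (insert r (S.filter fun p => det2 r z p < 0))
      (S.filter fun p => 0 < det2 r z p) S := by
  simpa using exists_separates hS hr hz hne (σ := 1) (by norm_num)

/-! ### Discrete intermediate values -/

/-- Among nested initial segments, weights change by steps of one. -/
lemma exists_crossing_of_key {w : Pt → ℤ} (hw : IsCol w) {X : Finset Pt} {k : Pt → ℝ}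
    (hk : Set.InjOn k X) {ℓ : ℤ} {D₁ : Finset Pt} (h₁ : wt w D₁ ≤ ℓ)
    (hl₁ : ∀ p ∈ D₁, ∀ q ∈ X, k q < k p → q ∈ D₁) (D₂ : Finset Pt) (hX : D₂ ⊆ X)
    (hD : D₁ ⊆ D₂) (hl₂ : ∀ p ∈ D₂, ∀ q ∈ X, k q < k p → q ∈ D₂) (h₂ : ℓ < wt w D₂) :
    ∃ β ∈ D₂, β ∉ D₁ ∧ w β = 1 ∧ wt w (X.filter fun q => k q < k β) = ℓ := by
  induction D₂ using Finset.strongInduction with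
  | H D₂ ih =>
  have hne : (D₂ \ D₁).Nonempty := by
    rw [Finset.sdiff_nonempty]
    intro hsub
    rw [Finset.Subset.antisymm hsub hD] at h₂
    omega
  obtain ⟨m, hm, hmax⟩ := Finset.exists_max_image (D₂ \ D₁) k hne
  obtain ⟨hm₂, hm₁⟩ := Finset.mem_sdiff.1 hm
  have hmax' : ∀ p ∈ D₂, p ≠ m → k p < k m := by
    intro p hp hpm
    refine lt_of_le_of_ne (le_of_not_gt fun hlt => ?_) fun h => hpm (hk (hX hp) (hX hm₂) h)
    by_cases hp₁ : p ∈ D₁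
    · exact hm₁ (hl₁ p hp₁ m (hX hm₂) hlt)
    · exact (hmax p (Finset.mem_sdiff.2 ⟨hp, hp₁⟩)).not_gt hlt
  have hpre : X.filter (fun q => k q < k m) = D₂.erase m := by
    ext q
    simp only [Finset.mem_filter, Finset.mem_erase]
    constructor
    · exact fun ⟨hq, hlt⟩ => ⟨fun h => by rw [h] at hlt; exact hlt.false, hl₂ m hm₂ q hq hlt⟩
    · exact fun ⟨hqm, hq⟩ => ⟨hX hq, hmax' q hq hqm⟩
  have hwm := wt_erase (c := w) hm₂
  by_cases hcase : wt w (D₂.erase m) ≤ ℓ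
  · rcases hw m with h | h
    · exact ⟨m, hm₂, hm₁, h, by rw [hpre]; omega⟩
    · omega
  · obtain ⟨β, hβ, h⟩ := ih (D₂.erase m) (Finset.erase_ssubset hm₂)
      ((Finset.erase_subset _ _).trans hX)
      (fun p hp => Finset.mem_erase.2 ⟨fun h => hm₁ (h ▸ hp), hD hp⟩)
      (fun p hp q hq hlt => by
        obtain ⟨hpm, hp₂⟩ := Finset.mem_erase.1 hp
        refine Finset.mem_erase.2 ⟨?_, hl₂ p hp₂ q hq hlt⟩
        rintro rfl
        exact (hmax' p hp₂ hpm).not_gt hlt)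
      (not_le.1 hcase)
    exact ⟨β, Finset.mem_of_mem_erase hβ, h⟩

/-- Around an exposed point the other points are linearly ordered by angle. -/
lemma Exposed.exists_key {S : Finset Pt} {r : Pt} (hr : Exposed S r) :
    ∃ k : Pt → ℝ, ∀ p ∈ S, ∀ q ∈ S, p ≠ r → q ≠ r → (k p < k q ↔ det2 r p q < 0) := by
  obtain ⟨a, ha⟩ := hr
  refine ⟨fun p => (a.1 * (p.2 - r.2) - a.2 * (p.1 - r.1)) / (dot a r - dot a p),
    fun p hp q hq hpr hqr => ?_⟩
  have h₁ := ha p hp hpr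
  have h₂ := ha q hq hqr
  have hn : 0 < a.1 ^ 2 + a.2 ^ 2 := by
    by_contra! h
    have h₁' : a.1 = 0 := by nlinarith [sq_nonneg a.1, sq_nonneg a.2]
    have h₂' : a.2 = 0 := by nlinarith [sq_nonneg a.1, sq_nonneg a.2]
    simp [dot, h₁', h₂'] at h₁
  have key : (a.1 * (p.2 - r.2) - a.2 * (p.1 - r.1)) * (dot a q - dot a r)
      - (a.1 * (q.2 - r.2) - a.2 * (q.1 - r.1)) * (dot a p - dot a r)
      = -((a.1 ^ 2 + a.2 ^ 2) * det2 r p q) := by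
    simp only [dot, det2]; ring
  have hneg : ∀ x : Pt, (a.1 * (x.2 - r.2) - a.2 * (x.1 - r.1)) / (dot a r - dot a x)
      = -((a.1 * (x.2 - r.2) - a.2 * (x.1 - r.1)) / (dot a x - dot a r)) := by
    intro x; rw [← neg_sub (dot a x), div_neg]
  simp only [hneg]
  rw [neg_lt_neg_iff, div_lt_div_iff₀ (by linarith) (by linarith), ← sub_pos,
    ← neg_pos (a := det2 r p q), ← mul_pos_iff_of_pos_left (b := -det2 r p q) hn]
  constructor <;> intro h <;> linarith

lemma exists_crossing {c : Pt → ℤ} (hc : IsCol c) {S X : Finset Pt} (hS : GenPos S) {r : Pt}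
    (hrS : r ∈ S) (hr : Exposed S r) (hXS : X ⊆ S) (hrX : r ∉ X) {ℓ : ℤ} {D₁ D₂ : Finset Pt}
    (hX : D₂ ⊆ X) (hD : D₁ ⊆ D₂) (hl₁ : ∀ p ∈ D₁, ∀ q ∈ X, 0 < det2 r p q → q ∈ D₁)
    (hl₂ : ∀ p ∈ D₂, ∀ q ∈ X, 0 < det2 r p q → q ∈ D₂) (h₁ : wt c D₁ ≤ ℓ) (h₂ : ℓ < wt c D₂) :
    ∃ β ∈ D₂, β ∉ D₁ ∧ c β = 1 ∧ wt c (X.filter fun q => 0 < det2 r β q) = ℓ := by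
  obtain ⟨k, hk⟩ := hr.exists_key
  have hne : ∀ p ∈ X, p ≠ r := fun p hp h => hrX (h ▸ hp)
  have hk' : ∀ p ∈ X, ∀ q ∈ X, (k q < k p ↔ 0 < det2 r p q) := by
    intro p hp q hq
    rw [hk q (hXS hq) p (hXS hp) (hne q hq) (hne p hp), det2_swap_right, neg_lt_zero]
  have hinj : Set.InjOn k X := by
    intro p hp q hq hpq
    by_contra hne'
    have h₁ := hk' p hp q hq
    have h₂ := hk' q hq p hp
    rw [hpq] at h₁ h₂
    have := hS r hrS p (hXS hp) q (hXS hq) (hne p hp).symm (hne q hq).symm hne'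
    rw [det2_swap_right] at h₂
    rcases lt_or_gt_of_ne this with h | h
    · exact (h₂.2 (by linarith)).false
    · exact (h₁.2 h).false
  obtain ⟨β, hβ, hβ₁, hcβ, hw⟩ := exists_crossing_of_key hc hinj h₁
    (fun p hp q hq h => hl₁ p hp q hq ((hk' p (hX (hD hp)) q hq).1 h)) D₂ hX hD
    (fun p hp q hq h => hl₂ p hp q hq ((hk' p (hX hp) q hq).1 h)) h₂
  refine ⟨β, hβ, hβ₁, hcβ, ?_⟩
  rw [← hw]
  congr 1
  exact Finset.filter_congr fun q hq => (hk' β (hX hβ) q hq).symm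

/-! ### Rotating a line about a point -/

lemma separates_filter {S : Finset Pt} {a z : Pt} (hz : z ∈ S)
    (h : ∀ p ∈ S, p ≠ z → dot a p ≠ dot a z) :
    Separates a z (S.filter fun p => dot a p < dot a z) (S.filter fun p => dot a z < dot a p)
      S where
  eq := by
    ext p
    simp only [Finset.mem_insert, Finset.mem_union, Finset.mem_filter]
    constructor
    · intro hp
      by_cases hpz : p = z
      · exact .inl hpz
      · rcases lt_or_gt_of_ne (h p hp hpz) with h | h <;> tauto
    · rintro (rfl | h | h)
      exacts [hz, h.1, h.1]
  low x hx := (Finset.mem_filter.1 hx).2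
  high x hx := (Finset.mem_filter.1 hx).2

namespace Separates

variable {a z : Pt} {L U S : Finset Pt}

lemma dot_ne (h : Separates a z L U S) {p : Pt} (hp : p ∈ S) (hpz : p ≠ z) :
    dot a p ≠ dot a z := by
  rw [h.eq] at hp
  rcases Finset.mem_union.1 (Finset.mem_of_mem_insert_of_ne hp hpz) with hp | hp
  exacts [(h.low p hp).ne, (h.high p hp).ne']

lemma low_eq (h : Separates a z L U S) : L = S.filter fun p => dot a p < dot a z := by
  ext p
  rw [Finset.mem_filter]
  refine ⟨fun hp => ⟨h.low_subset (Finset.mem_insert_of_mem hp), h.low p hp⟩, fun ⟨hp, hlt⟩ => ?_⟩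
  rw [h.eq, Finset.mem_insert, Finset.mem_union] at hp
  rcases hp with rfl | hp | hp
  exacts [absurd hlt (lt_irrefl _), hp, absurd hlt (h.high p hp).not_gt]

end Separates

lemma det2_eq_zero_of_dot {n x p q : Pt} (hn : n ≠ 0) (hp : dot n p = dot n x)
    (hq : dot n q = dot n x) : det2 x p q = 0 := by
  have hp' : n.1 * (p.1 - x.1) + n.2 * (p.2 - x.2) = 0 := by simp only [dot] at hp; linarith
  have hq' : n.1 * (q.1 - x.1) + n.2 * (q.2 - x.2) = 0 := by simp only [dot] at hq; linarith
  have h₁ : n.1 * det2 x p q = 0 := by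
    simp only [det2]
    linear_combination (q.2 - x.2) * hp' - (p.2 - x.2) * hq'
  have h₂ : n.2 * det2 x p q = 0 := by
    simp only [det2]
    linear_combination (p.1 - x.1) * hq' - (q.1 - x.1) * hp'
  by_contra hne
  exact hn (Prod.ext ((mul_eq_zero.1 h₁).resolve_right hne) ((mul_eq_zero.1 h₂).resolve_right hne))

/-- If two lines through `x` have nonnegative and nonpositive weight below them, some line between
them has weight zero below it. -/
lemma exists_separates_wt_eq_zero {c : Pt → ℤ} (hc : IsCol c) {S : Finset Pt} (hS : GenPos S)
    {x r r' a₀ a₁ : Pt} {L₀ U₀ L₁ U₁ : Finset Pt} (h₀ : Separates a₀ x L₀ U₀ S)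
    (h₁ : Separates a₁ x L₁ U₁ S) (hr₀ : r ∈ L₀) (hr₁ : r ∈ L₁) (hr₀' : r' ∈ U₀) (hr₁' : r' ∈ U₁)
    (hw₀ : 0 ≤ wt c L₀) (hw₁ : wt c L₁ ≤ 0) :
    ∃ a L U, Separates a x L U S ∧ r ∈ L ∧ r' ∈ U ∧ wt c L = 0 := by
  rcases hw₀.eq_or_lt with hw₀ | hw₀
  · exact ⟨a₀, L₀, U₀, h₀, hr₀, hr₀', hw₀.symm⟩
  rcases hw₁.eq_or_lt with hw₁ | hw₁
  · exact ⟨a₁, L₁, U₁, h₁, hr₁, hr₁', hw₁⟩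
  set φ₀ : Pt → ℝ := fun p => dot a₀ p - dot a₀ x with hφ₀
  set φ₁ : Pt → ℝ := fun p => dot a₁ p - dot a₁ x with hφ₁
  set X := S.filter fun p => φ₀ p * φ₁ p < 0 with hX
  set k : Pt → ℝ := fun p => φ₀ p / (φ₀ p - φ₁ p) with hk
  set w : Pt → ℤ := fun p => if 0 < φ₀ p then -c p else c p with hw
  have hwc : IsCol w := fun p => by
    have := hc p
    simp only [hw]
    split <;> omega
  have hxS := h₀.mem
  have hφx : φ₀ x = 0 ∧ φ₁ x = 0 := by simp [hφ₀, hφ₁]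
  have hne₀ : ∀ p ∈ S, p ≠ x → φ₀ p ≠ 0 := fun p hp hpx => sub_ne_zero.2 (h₀.dot_ne hp hpx)
  have hne₁ : ∀ p ∈ S, p ≠ x → φ₁ p ≠ 0 := fun p hp hpx => sub_ne_zero.2 (h₁.dot_ne hp hpx)
  have hXx : ∀ p ∈ X, p ∈ S ∧ p ≠ x := fun p hp => by
    obtain ⟨hp, hlt⟩ := Finset.mem_filter.1 hp
    refine ⟨hp, ?_⟩
    rintro rfl
    rw [hφx.1, zero_mul] at hlt
    exact hlt.false
  have hk01 : ∀ p ∈ X, 0 < k p ∧ k p < 1 := by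
    intro p hp
    have hlt := (Finset.mem_filter.1 hp).2
    rcases mul_neg_iff.1 hlt with ⟨h, h'⟩ | ⟨h, h'⟩
    · exact ⟨div_pos h (by linarith), (div_lt_one (by linarith)).2 (by linarith)⟩
    · exact ⟨div_pos_of_neg_of_neg h (by linarith),
        (div_lt_one_of_neg (by linarith)).2 (by linarith)⟩
  have hdot : ∀ τ p, dot ((1 - τ) • a₀ + τ • a₁) p - dot ((1 - τ) • a₀ + τ • a₁) x
      = (1 - τ) * φ₀ p + τ * φ₁ p := fun τ p => by
    rw [dot_add_smul, dot_add_smul]; simp only [hφ₀, hφ₁]; ring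
  have hrlow : φ₀ r < 0 ∧ φ₁ r < 0 := ⟨sub_neg.2 (h₀.low r hr₀), sub_neg.2 (h₁.low r hr₁)⟩
  have hrhigh : 0 < φ₀ r' ∧ 0 < φ₁ r' :=
    ⟨sub_pos.2 (h₀.high r' hr₀'), sub_pos.2 (h₁.high r' hr₁')⟩
  have hrS := h₀.low_subset (Finset.mem_insert_of_mem hr₀)
  have hrS' := h₀.high_subset (Finset.mem_insert_of_mem hr₀')
  have hzero : ∀ p ∈ X, (1 - k p) * φ₀ p + k p * φ₁ p = 0 := by
    intro p hp
    have hlt := (Finset.mem_filter.1 hp).2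
    have : φ₀ p - φ₁ p ≠ 0 := fun h => by
      rw [sub_eq_zero.1 h] at hlt; nlinarith [mul_self_nonneg (φ₁ p)]
    simp only [hk]
    field_simp
    ring
  have hinj : Set.InjOn k X := by
    intro p hp q hq hpq
    by_contra hne
    have hn : (1 - k p) • a₀ + k p • a₁ ≠ 0 := by
      intro h
      have h₃ := hdot (k p) r
      obtain ⟨h₁, h₂⟩ := hk01 p hp
      rw [h] at h₃
      simp only [dot, Prod.fst_zero, Prod.snd_zero, zero_mul, add_zero, sub_zero] at h₃
      nlinarith [mul_pos (sub_pos.2 h₂) (neg_pos.2 hrlow.1), mul_pos h₁ (neg_pos.2 hrlow.2)]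
    have hp' := hdot (k p) p
    have hq' := hdot (k p) q
    rw [hzero p hp] at hp'
    rw [hpq, hzero q hq, ← hpq] at hq'
    exact hS x hxS p (hXx p hp).1 q (hXx q hq).1 (hXx p hp).2.symm (hXx q hq).2.symm hne
      (det2_eq_zero_of_dot hn (sub_eq_zero.1 hp') (sub_eq_zero.1 hq'))
  have hL₀ : wt c L₀ = ∑ p ∈ S, if φ₀ p < 0 then c p else 0 := by
    rw [h₀.low_eq, wt, Finset.sum_filter]
    simp only [hφ₀, sub_neg]
  have hL₁ : wt c L₁ = ∑ p ∈ S, if φ₁ p < 0 then c p else 0 := by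
    rw [h₁.low_eq, wt, Finset.sum_filter]
    simp only [hφ₁, sub_neg]
  have hwX : wt w X = wt c L₀ - wt c L₁ := by
    rw [hL₀, hL₁, ← Finset.sum_sub_distrib, wt, hX, Finset.sum_filter]
    refine Finset.sum_congr rfl fun p hp => ?_
    by_cases hpx : p = x
    · subst hpx; simp [hφx.1, hφx.2]
    simp only [hw, mul_neg_iff]
    rcases lt_or_gt_of_ne (hne₀ p hp hpx) with h | h <;>
    rcases lt_or_gt_of_ne (hne₁ p hp hpx) with h' | h' <;>
    simp [h, h', h.not_gt, h'.not_gt]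
  obtain ⟨β, hβ, -, -, hwβ⟩ := exists_crossing_of_key (ℓ := wt c L₀) hwc hinj (D₁ := ∅)
    (by rw [show wt w ∅ = 0 from Finset.sum_empty]; exact hw₀.le) (by simp) X
    (Finset.Subset.refl _) (by simp) (fun _ _ q hq _ => hq)
    (by rw [hwX]; omega)
  obtain ⟨hβ0, hβ1⟩ := hk01 β hβ
  set n := (1 - k β) • a₀ + k β • a₁ with hn
  obtain ⟨ε, hε, hε'⟩ := exists_tilt S n a₀ x
  have hsame : ∀ p ∈ S, p ≠ x → p ∉ X →
      (φ₀ p < 0 ∧ dot n p < dot n x) ∨ (0 < φ₀ p ∧ dot n x < dot n p) := by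
    intro p hp hpx hpX
    have hd := hdot (k β) p
    have hX' : 0 ≤ φ₀ p * φ₁ p := not_lt.1 fun h => hpX (Finset.mem_filter.2 ⟨hp, h⟩)
    rcases lt_or_gt_of_ne (hne₀ p hp hpx) with h | h
    · have h' : φ₁ p < 0 := lt_of_le_of_ne (by nlinarith) (hne₁ p hp hpx)
      exact .inl ⟨h, by
        nlinarith [mul_pos (sub_pos.2 hβ1) (neg_pos.2 h), mul_pos hβ0 (neg_pos.2 h')]⟩
    · have h' : 0 < φ₁ p := lt_of_le_of_ne (by nlinarith) (hne₁ p hp hpx).symm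
      exact .inr ⟨h, by nlinarith [mul_pos (sub_pos.2 hβ1) h, mul_pos hβ0 h']⟩
  have hflip : ∀ p ∈ X, (0 < φ₀ p → (dot n p < dot n x ↔ k p < k β) ∧
      (dot n x < dot n p ↔ k β < k p)) ∧
      (φ₀ p < 0 → (dot n x < dot n p ↔ k p < k β) ∧ (dot n p < dot n x ↔ k β < k p)) := by
    intro p hp
    have hlt := (Finset.mem_filter.1 hp).2
    have hd := hdot (k β) p
    have e : (1 - k β) * φ₀ p + k β * φ₁ p = φ₀ p - k β * (φ₀ p - φ₁ p) := by ring
    rw [e] at hd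
    refine ⟨fun h => ?_, fun h => ?_⟩
    · have h' : φ₁ p < 0 := by by_contra! h'; nlinarith
      have hpos : 0 < φ₀ p - φ₁ p := by linarith
      simp only [hk]
      rw [div_lt_iff₀ hpos, lt_div_iff₀ hpos, ← sub_neg, ← sub_pos (a := dot n p), hd]
      exact ⟨sub_neg, sub_pos⟩
    · have h' : 0 < φ₁ p := by by_contra! h'; nlinarith
      have hneg : φ₀ p - φ₁ p < 0 := by linarith
      simp only [hk]
      rw [div_lt_iff_of_neg hneg, lt_div_iff_of_neg hneg, ← sub_pos, ← sub_neg (a := dot n p), hd]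
      exact ⟨sub_pos, sub_neg⟩
  have hfin : ∀ p ∈ S, p ≠ x →
      (dot (n + ε • a₀) p < dot (n + ε • a₀) x ∧
        ((φ₀ p < 0 ∧ ¬ (p ∈ X ∧ k p < k β)) ∨ (0 < φ₀ p ∧ p ∈ X ∧ k p < k β))) ∨
      (dot (n + ε • a₀) x < dot (n + ε • a₀) p ∧
        ((0 < φ₀ p ∧ ¬ (p ∈ X ∧ k p < k β)) ∨ (φ₀ p < 0 ∧ p ∈ X ∧ k p < k β))) := by
    intro p hp hpx
    by_cases hpX : p ∈ X
    · rcases lt_trichotomy (k p) (k β) with h | h | h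
      · rcases lt_or_gt_of_ne (hne₀ p hp hpx) with h₀ | h₀
        · exact .inr ⟨(hε' p hp).2 (((hflip p hpX).2 h₀).1.2 h), .inr ⟨h₀, hpX, h⟩⟩
        · exact .inl ⟨(hε' p hp).1 (((hflip p hpX).1 h₀).1.2 h), .inr ⟨h₀, hpX, h⟩⟩
      · have hd := hdot (k β) p
        rw [← h, hzero p hpX, h] at hd
        have hd' : dot n p = dot n x := sub_eq_zero.1 hd
        rw [dot_add_smul_right n a₀ p ε, dot_add_smul_right n a₀ x ε, hd']
        rcases lt_or_gt_of_ne (hne₀ p hp hpx) with h₀ | h₀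
        · refine .inl ⟨?_, .inl ⟨h₀, fun h' => h'.2.ne h⟩⟩
          have := mul_lt_mul_of_pos_left (sub_neg.1 h₀) hε
          linarith
        · refine .inr ⟨?_, .inl ⟨h₀, fun h' => h'.2.ne h⟩⟩
          have := mul_lt_mul_of_pos_left (sub_pos.1 h₀) hε
          linarith
      · rcases lt_or_gt_of_ne (hne₀ p hp hpx) with h₀ | h₀
        · exact .inl ⟨(hε' p hp).1 (((hflip p hpX).2 h₀).2.2 h), .inl ⟨h₀, fun h' => h'.2.not_gt h⟩⟩
        · exact .inr ⟨(hε' p hp).2 (((hflip p hpX).1 h₀).2.2 h), .inl ⟨h₀, fun h' => h'.2.not_gt h⟩⟩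
    · rcases hsame p hp hpx hpX with ⟨h₀, h⟩ | ⟨h₀, h⟩
      · exact .inl ⟨(hε' p hp).1 h, .inl ⟨h₀, fun h' => hpX h'.1⟩⟩
      · exact .inr ⟨(hε' p hp).2 h, .inl ⟨h₀, fun h' => hpX h'.1⟩⟩
  have hrX : ∀ p, 0 < φ₀ p * φ₁ p → p ∉ X := fun p h hp => h.not_gt (Finset.mem_filter.1 hp).2
  refine ⟨n + ε • a₀, _, _, separates_filter hxS fun p hp hpx => ?_, ?_, ?_, ?_⟩
  · rcases hfin p hp hpx with h | h
    exacts [h.1.ne, h.1.ne']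
  · refine Finset.mem_filter.2 ⟨hrS, ?_⟩
    have hrx : r ≠ x := fun h => by rw [h, hφx.1] at hrlow; exact hrlow.1.false
    rcases hsame r hrS hrx (hrX r (mul_pos_of_neg_of_neg hrlow.1 hrlow.2)) with h | h
    · exact (hε' r hrS).1 h.2
    · exact absurd h.1 hrlow.1.not_gt
  · refine Finset.mem_filter.2 ⟨hrS', ?_⟩
    have hrx : r' ≠ x := fun h => by rw [h, hφx.1] at hrhigh; exact hrhigh.1.false
    rcases hsame r' hrS' hrx (hrX r' (mul_pos hrhigh.1 hrhigh.2)) with h | h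
    · exact absurd h.1 hrhigh.1.not_gt
    · exact (hε' r' hrS').2 h.2
  · have key : wt c (S.filter fun p => dot (n + ε • a₀) p < dot (n + ε • a₀) x)
        = wt c L₀ - wt w (X.filter fun q => k q < k β) := by
      rw [hL₀, wt, wt, Finset.sum_filter, hX, Finset.filter_filter, Finset.sum_filter,
        ← Finset.sum_sub_distrib]
      refine Finset.sum_congr rfl fun p hp => ?_
      by_cases hpx : p = x
      · subst hpx; simp [hφx.1, hφx.2]
      have hmem : (φ₀ p * φ₁ p < 0 ∧ k p < k β) ↔ (p ∈ X ∧ k p < k β) := by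
        rw [hX, Finset.mem_filter]; tauto
      simp only [hmem, hw]
      rcases hfin p hp hpx with ⟨h, ⟨h', h''⟩ | ⟨h', h''⟩⟩ | ⟨h, ⟨h', h''⟩ | ⟨h', h''⟩⟩
      · rw [if_pos h, if_pos h', if_neg h'', sub_zero]
      · rw [if_pos h, if_neg h'.not_gt, if_pos h'', if_pos h']; ring
      · rw [if_neg h.not_gt, if_neg h'.not_gt, if_neg h'', sub_zero]
      · rw [if_neg h.not_gt, if_pos h', if_pos h'', if_neg h'.not_gt, sub_self]
    rw [key, hwβ, sub_self]

/-! ### Splitting at a vertex -/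

/-- Point sets with fewer than `N` points satisfy the two statements proved by induction: one for
opposite coloured ends of a hull edge, one for equally coloured exposed points. -/
structure GoodBelow (c : Pt → ℤ) (N : ℕ) : Prop where
  edge : ∀ T : Finset Pt, T.card < N → GenPos T → wt c T = 0 → ∀ p ∈ T, ∀ q ∈ T, c p + c q = 0 →
    (∀ x ∈ T, x ≠ p → x ≠ q → 0 < det2 p q x) → Good c T p q
  exposed : ∀ T : Finset Pt, T.card < N → GenPos T → ∀ p ∈ T, ∀ q ∈ T, p ≠ q → Exposed T p →
    Exposed T q → wt c T = c p → c q = c p → Good c T p q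

lemma GoodBelow.neg {c : Pt → ℤ} {N : ℕ} (h : GoodBelow c N) : GoodBelow (-c) N where
  edge T hT hgp hw p hp q hq hpq hx := by
    refine (h.edge T hT hgp ?_ p hp q hq ?_ hx).neg
    · rw [wt_neg] at hw; omega
    · simp only [Pi.neg_apply] at hpq; omega
  exposed T hT hgp p hp q hq hpq hep heq hw hpq' := by
    refine (h.exposed T hT hgp p hp q hq hpq hep heq ?_ ?_).neg
    · rw [wt_neg, Pi.neg_apply] at hw; omega
    · simp only [Pi.neg_apply] at hpq'; omega

@[simp] lemma det2_self (p q : Pt) : det2 p p q = 0 := by simp only [det2]; ring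

@[simp] lemma det2_left_eq (p q : Pt) : det2 p q p = 0 := by simp only [det2]; ring

@[simp] lemma det2_right_eq (p q : Pt) : det2 p q q = 0 := by simp only [det2]; ring

lemma even_card_of_wt_eq_zero {c : Pt → ℤ} (hc : IsCol c) {S : Finset Pt} (h : wt c S = 0) :
    Even S.card := by
  obtain ⟨m, hm⟩ := wt_parity hc S
  exact (Int.even_coe_nat _).1 ⟨m, by omega⟩

namespace GoodBelow

variable {c : Pt → ℤ} {S : Finset Pt}

/-- Gluing at a point `z` whose high side is balanced and contains the second endpoint. -/
lemma good_of_separates (H : GoodBelow c S.card) (hc : IsCol c) (hS : GenPos S) {a z p q : Pt}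
    {L U : Finset Pt} (h : Separates a z L U S) (hL : Good c (insert z L) p z) (hp : p ∈ L)
    (hq : q ∈ U) (hq' : Exposed S q) (hw : wt c U = 0) (hcq : c q = c z) : Good c S p q := by
  have hU : Even U.card := even_card_of_wt_eq_zero hc hw
  refine h.good hc hS hL ?_ hU
  have hcard := h.card_eq
  have hL' : 0 < L.card := Finset.card_pos.2 ⟨p, hp⟩
  refine H.exposed _ ?_ (hS.mono h.high_subset) z (Finset.mem_insert_self _ _) q
    (Finset.mem_insert_of_mem hq) (fun e => h.notMem_high (e ▸ hq)) h.exposed_high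
    (hq'.mono h.high_subset) ?_ hcq
  · rw [Finset.card_insert_of_notMem h.notMem_high]; omega
  · rw [wt_insert h.notMem_high, hw, add_zero]

/-- Two equally coloured exposed points separated by a line through a point of their colour that
balances both sides are joined by a good path. -/
lemma good_of_balanced (H : GoodBelow c S.card) (hc : IsCol c) (hS : GenPos S) {a z p q : Pt}
    {L U : Finset Pt} (h : Separates a z L U S) (hp : p ∈ L) (hp' : Exposed S p)
    (hq : q ∈ U) (hq' : Exposed S q) (hL : wt c L = 0) (hU : wt c U = 0) (hcp : c p = c z)
    (hcq : c q = c z) : Good c S p q := by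
  refine H.good_of_separates hc hS h ?_ hp hq hq' hU hcq
  have hcard := h.card_eq
  have hU' : 0 < U.card := Finset.card_pos.2 ⟨q, hq⟩
  refine H.exposed _ ?_ (hS.mono h.low_subset) p (Finset.mem_insert_of_mem hp) z
    (Finset.mem_insert_self _ _) (fun e => h.notMem_low (e ▸ hp)) (hp'.mono h.low_subset)
    h.exposed_low ?_ hcp.symm
  · rw [Finset.card_insert_of_notMem h.notMem_low]; omega
  · rw [wt_insert h.notMem_low, hL, add_zero, hcp]

/-- A line through `r` and a point `β` coloured like `b` that balances the points on each side. -/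
lemma good_of_split (H : GoodBelow c S.card) (hc : IsCol c) (hS : GenPos S) (hw : wt c S = 0)
    {r b β : Pt} (hr : r ∈ S) (hb : b ∈ S) (hβ : β ∈ S) (hbe : Exposed S b) (hrb : c r + c b = 0)
    (hβb : β ≠ b) (hcβ : c β = c b) (hside : wt c (S.filter fun p => 0 < det2 r β p) = 0) :
    Good c S r b := by
  have hne : ∀ x : Pt, c x = c b → r ≠ x := by
    rintro x hx rfl; have := hc r; omega
  rcases lt_or_gt_of_ne (hS r hr β hβ b hb (hne β hcβ) (hne b rfl) hβb) with h | h
  · obtain ⟨a, ha⟩ := exists_separates_pos hS hr hβ (hne β hcβ)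
    have hbU : b ∈ S.filter fun p => det2 r β p < 0 := Finset.mem_filter.2 ⟨hb, h⟩
    have hL : wt c (insert r (S.filter fun p => 0 < det2 r β p)) = c r := by
      rw [wt_insert (by simp [det2_left_eq]), hside, add_zero]
    have hU := ha.wt_eq c
    have hcard := ha.card_eq
    have hU' := Finset.card_pos.2 ⟨b, hbU⟩
    refine H.good_of_separates hc hS ha ?_ (Finset.mem_insert_self _ _) hbU hbe (by omega) hcβ.symm
    refine H.edge _ ?_ (hS.mono ha.low_subset) ?_ r (by simp) β (by simp) (by omega) ?_
    · rw [Finset.card_insert_of_notMem ha.notMem_low]; omega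
    · rw [wt_insert ha.notMem_low]; omega
    · intro x hx hxr hxβ
      exact (Finset.mem_filter.1 (Finset.mem_of_mem_insert_of_ne
        (Finset.mem_of_mem_insert_of_ne hx hxβ) hxr)).2
  · obtain ⟨a, ha⟩ := exists_separates_neg hS hr hβ (hne β hcβ)
    have hbU : b ∈ S.filter fun p => 0 < det2 r β p := Finset.mem_filter.2 ⟨hb, h⟩
    have hU := ha.wt_eq c
    have hcard := ha.card_eq
    have hU' := Finset.card_pos.2 ⟨b, hbU⟩
    refine H.good_of_separates hc hS ha ?_ (Finset.mem_insert_self _ _) hbU hbe hside hcβ.symm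
    refine (H.edge _ ?_ (hS.mono ha.low_subset) ?_ β (by simp) r (by simp) (by omega) ?_).reverse
    · rw [Finset.card_insert_of_notMem ha.notMem_low]; omega
    · rw [wt_insert ha.notMem_low]; omega
    · intro x hx hxβ hxr
      rw [det2_swap]
      exact neg_pos.2 (Finset.mem_filter.1 (Finset.mem_of_mem_insert_of_ne
        (Finset.mem_of_mem_insert_of_ne hx hxβ) hxr)).2

end GoodBelow

/-! ### Opposite coloured ends of a hull edge -/

lemma Exposed.exists_first {S Y : Finset Pt} {r : Pt} (hr : Exposed S r) (hY : Y ⊆ S) (hrY : r ∉ Y)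
    (hS : GenPos S) (hrS : r ∈ S) (hne : Y.Nonempty) :
    ∃ p ∈ Y, ∀ q ∈ Y, q ≠ p → det2 r p q < 0 := by
  obtain ⟨k, hk⟩ := hr.exists_key
  obtain ⟨p, hp, hmin⟩ := Finset.exists_min_image Y k hne
  have hn : ∀ q ∈ Y, q ≠ r := fun q hq e => hrY (e ▸ hq)
  refine ⟨p, hp, fun q hq hqp => lt_of_le_of_ne (not_lt.1 fun h => ?_)
    (hS r hrS p (hY hp) q (hY hq) (hn p hp).symm (hn q hq).symm hqp.symm)⟩
  refine (hmin q hq).not_gt ((hk q (hY hq) p (hY hp) (hn q hq) (hn p hp)).2 ?_)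
  rw [det2_swap_right]; linarith

lemma Exposed.exists_last {S Y : Finset Pt} {r : Pt} (hr : Exposed S r) (hY : Y ⊆ S) (hrY : r ∉ Y)
    (hS : GenPos S) (hrS : r ∈ S) (hne : Y.Nonempty) :
    ∃ p ∈ Y, ∀ q ∈ Y, q ≠ p → 0 < det2 r p q := by
  obtain ⟨k, hk⟩ := hr.exists_key
  obtain ⟨p, hp, hmax⟩ := Finset.exists_max_image Y k hne
  have hn : ∀ q ∈ Y, q ≠ r := fun q hq e => hrY (e ▸ hq)
  refine ⟨p, hp, fun q hq hqp => lt_of_le_of_ne (not_lt.1 fun h => ?_)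
    (hS r hrS p (hY hp) q (hY hq) (hn p hp).symm (hn q hq).symm hqp.symm).symm⟩
  exact (hmax q hq).not_gt ((hk p (hY hp) q (hY hq) (hn p hp) (hn q hq)).2 h)

namespace GoodBelow

variable {c : Pt → ℤ} {S : Finset Pt}

lemma good_edge_aux (H : GoodBelow c S.card) (hc : IsCol c) (hS : GenPos S) (hw : wt c S = 0)
    {r b : Pt} (hr : r ∈ S) (hb : b ∈ S) (hcr : c r = 1) (hcb : c b = -1)
    (hrb : ∀ p ∈ S, p ≠ r → p ≠ b → 0 < det2 r b p) : Good c S r b := by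
  have hne : r ≠ b := by rintro rfl; omega
  have hre := exposed_of_edge hne hrb
  have hbe := exposed_of_edge' hne hrb
  by_cases hsr : ∃ β ∈ S, β ≠ b ∧ c β = -1 ∧ wt c (S.filter fun p => 0 < det2 r β p) = 0
  · obtain ⟨β, hβ, hβb, hcβ, hβw⟩ := hsr
    exact H.good_of_split hc hS hw hr hb hβ hbe (by omega) hβb (by omega) hβw
  by_cases hsb : ∃ β ∈ S, β ≠ r ∧ c β = 1 ∧ wt c (S.filter fun p => 0 < det2 b β p) = 0
  · obtain ⟨β, hβ, hβr, hcβ, hβw⟩ := hsb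
    exact (H.good_of_split hc hS hw hb hr hβ hre (by omega) hβr (by omega) hβw).reverse
  push Not at hsr hsb
  set Q := (S.erase r).erase b with hQ
  have hmemQ : ∀ p, p ∈ Q ↔ p ≠ b ∧ p ≠ r ∧ p ∈ S := fun p => by simp [hQ]
  have hbr : b ∈ S.erase r := Finset.mem_erase.2 ⟨hne.symm, hb⟩
  have hSQ : insert r (insert b Q) = S := by
    rw [hQ, Finset.insert_erase hbr, Finset.insert_erase hr]
  have hQS : Q ⊆ S := fun p hp => ((hmemQ p).1 hp).2.2
  have hrQ : r ∉ Q := fun h => ((hmemQ r).1 h).2.1 rfl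
  have hbQ : b ∉ Q := fun h => ((hmemQ b).1 h).1 rfl
  have hrbQ : r ∉ insert b Q := by simp [hne, hrQ]
  have hwQ : wt c Q = 0 := by rw [hQ, wt_erase hbr, wt_erase hr]; omega
  have hcard : S.card = Q.card + 2 := by
    rw [← hSQ, Finset.card_insert_of_notMem hrbQ, Finset.card_insert_of_notMem hbQ]
  have hedge : ∀ p ∈ Q, 0 < det2 r b p := fun p hp =>
    hrb p (hQS hp) ((hmemQ p).1 hp).2.1 ((hmemQ p).1 hp).1
  rcases Q.eq_empty_or_nonempty with hQ0 | hQ0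
  · rw [← hSQ, hQ0]
    exact good_pair hne (by omega)
  obtain ⟨y, hy, hymax⟩ := hre.exists_last hQS hrQ hS hr hQ0
  obtain ⟨z, hz, hzmin⟩ := hbe.exists_first hQS hbQ hS hb hQ0
  have hcy : c y = -1 := by
    by_contra hcy
    have hlow : ∀ p ∈ Q.erase y, ∀ q ∈ Q, 0 < det2 r p q → q ∈ Q.erase y := by
      refine fun p hp q hq hpq => Finset.mem_erase.2 ⟨?_, hq⟩
      rintro rfl
      obtain ⟨hpy, hp⟩ := Finset.mem_erase.1 hp
      have := hymax p hp hpy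
      rw [det2_swap_right] at this; linarith
    have hwt : 0 < wt (-c) (Q.erase y) := by
      have := hc y
      rw [wt_neg, wt_erase hy]; omega
    obtain ⟨β, hβ, -, hcβ, hwβ⟩ := exists_crossing hc.neg hS hr hre hQS hrQ (ℓ := 0) (D₁ := ∅)
      (Finset.erase_subset _ _) (Finset.empty_subset _) (by simp) hlow (by simp [wt]) hwt
    have hβQ := Finset.mem_of_mem_erase hβ
    have hcβ' : c β = -1 := by simp only [Pi.neg_apply] at hcβ; omega
    refine hsr β (hQS hβQ) ((hmemQ β).1 hβQ).1 hcβ' ?_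
    have hb' : ¬ 0 < det2 r β b := by
      have := hedge β hβQ
      rw [det2_swap_right]; linarith
    rw [← hSQ, Finset.filter_insert, if_neg (by simp), Finset.filter_insert, if_neg hb']
    rw [wt_neg] at hwβ; omega
  have hcz : c z = 1 := by
    by_contra hcz
    have hlow : ∀ p ∈ ({z} : Finset Pt), ∀ q ∈ Q, 0 < det2 b p q → q ∈ ({z} : Finset Pt) := by
      intro p hp q hq hpq
      rw [Finset.mem_singleton] at hp ⊢
      subst hp
      by_contra hqp
      exact (hzmin q hq hqp).not_gt hpq
    have hwt : wt c {z} ≤ -1 := by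
      have := hc z
      simp only [wt, Finset.sum_singleton]; omega
    obtain ⟨β, hβ, -, hcβ, hwβ⟩ := exists_crossing hc hS hb hbe hQS hbQ (ℓ := -1)
      (Finset.Subset.refl _) (by simpa using hz) hlow (fun _ _ q hq _ => hq) hwt (by omega)
    refine hsb β (hQS hβ) ((hmemQ β).1 hβ).2.1 hcβ ?_
    have hr' : 0 < det2 b β r := by
      have := hedge β hβ
      rwa [det2_rotate] at this
    rw [← hSQ, Finset.filter_insert, if_pos hr', Finset.filter_insert, if_neg (by simp),
      wt_insert (by simp [hrQ]), hwβ]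
    omega
  have hzr : det2 z b r < 0 := by
    have := hedge z hz
    rw [← det2_rotate, det2_swap_right]; linarith
  have hyb : det2 r y b < 0 := by
    have := hedge y hy
    rw [det2_swap_right]; linarith
  have hzb : ∀ p ∈ Q, p ≠ z → 0 < det2 z b p := fun p hp hpz => by
    have := hzmin p hp hpz
    rw [det2_swap]; linarith
  have hyz : y ≠ z := by rintro rfl; omega
  have hf : ∀ x, dot (rot z b) x = dot (rot z b) z + det2 z b x := fun x => by
    rw [← dot_rot_sub]; ring
  have hg : ∀ x, dot (rot r y) x = dot (rot r y) r + det2 r y x := fun x => by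
    rw [← dot_rot_sub]; ring
  obtain ⟨u, v, α, β, huv, hα, hβ, hline, hmin, hbelow⟩ := exists_hullArc hc (hS.mono hQS)
    (f := rot z b) (g := rot r y) (z := z) (v₀ := y) (by
      have h₁ : (rot z b).1 * (rot r y).2 - (rot z b).2 * (rot r y).1 =
          det2 z b y - det2 z b r := by
        simp only [rot, det2]; ring
      have := hzb y hy hyz
      linarith) hz hcz (fun p hp hpz => by rw [hf p]; linarith [hzb p hp hpz]) hy hcy
    (fun p hp hpy => by rw [hg p, hg y, det2_right_eq]; linarith [hymax p hp hpy])
  obtain ⟨⟨hu, hv⟩, hcu, hcv, harc⟩ := mem_hullArcs.1 huv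
  have hu₀ : α * dot (rot z b) z + β * dot (rot r y) r ≤
      α * dot (rot z b) u + β * dot (rot r y) u := by
    refine add_le_add (mul_le_mul_of_nonneg_left ?_ hα.le) (mul_le_mul_of_nonneg_left ?_ hβ.le)
    · rw [hf u]
      rcases eq_or_ne u z with rfl | h
      · simp
      · linarith [hzb u hu h]
    · rw [hg u]
      rcases eq_or_ne u y with rfl | h
      · simp
      · linarith [hymax u hu h]
  have hrlow : α * dot (rot z b) r + β * dot (rot r y) r
      < α * dot (rot z b) u + β * dot (rot r y) u := by
    refine lt_of_lt_of_le ?_ hu₀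
    rw [hf r]
    nlinarith
  have hblow : α * dot (rot z b) b + β * dot (rot r y) b
      < α * dot (rot z b) u + β * dot (rot r y) u := by
    refine lt_of_lt_of_le ?_ hu₀
    rw [hf b, hg b, det2_right_eq]
    nlinarith
  obtain ⟨k, hk, hk₁, hk₂⟩ := H.edge Q (by omega) (hS.mono hQS) hwQ u hu v hv (by omega) harc
  obtain ⟨k', hk', hpath⟩ := hk.reverse.extend (a := α • rot z b + β • rot r y)
    (t := α * dot (rot z b) u + β * dot (rot r y) u) (r := r) (b := b)
    (by simpa only [dot_add_smul] using hmin) (by rw [dot_add_smul])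
    (by rw [dot_add_smul]; exact hline.ge) (by rwa [dot_add_smul]) (by rwa [dot_add_smul]) hne
    (by omega) (by omega)
  rw [hSQ] at hpath
  have h₁ : hullArcs c S ⊆ insert (r, b) ((hullArcs c Q).erase (u, v)) := by
    rintro ⟨s, t⟩ h
    obtain ⟨⟨hs, ht⟩, hcs, hct, hst⟩ := mem_hullArcs.1 h
    have hsb' : s ≠ b := by rintro rfl; omega
    have htr : t ≠ r := by rintro rfl; omega
    by_cases hsr' : s = r
    · subst hsr'
      by_cases htb : t = b
      · subst htb; simp
      · have h₁ := hrb t ht htr htb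
        have h₂ := hst b hb hne.symm (Ne.symm htb)
        rw [det2_swap_right] at h₂; linarith
    by_cases htb : t = b
    · subst htb
      have h₁ := hrb s hs hsr' hsb'
      have h₂ := hst r hr (Ne.symm hsr') htr.symm
      rw [← det2_rotate, det2_swap_right] at h₂; linarith
    refine Finset.mem_insert_of_mem (Finset.mem_erase.2 ⟨?_, mem_hullArcs.2
      ⟨⟨(hmemQ s).2 ⟨hsb', hsr', hs⟩, (hmemQ t).2 ⟨htb, htr, ht⟩⟩, hcs, hct,
        fun p hp => hst p (hQS hp)⟩⟩)
    intro e
    obtain ⟨rfl, rfl⟩ := Prod.mk.inj e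
    exact (hbelow r hrlow).not_gt (hst r hr (Ne.symm hsr') htr.symm)
  have h₂ : hullArcs (-c) S ⊆ hullArcs (-c) Q := by
    rintro ⟨s, t⟩ h
    obtain ⟨⟨hs, ht⟩, hcs, hct, hst⟩ := mem_hullArcs.1 h
    have hcs' : c s = -1 := by simp only [Pi.neg_apply] at hcs; omega
    have hct' : c t = 1 := by simp only [Pi.neg_apply] at hct; omega
    have hsr' : s ≠ r := by rintro rfl; omega
    have htb : t ≠ b := by rintro rfl; omega
    by_cases hsb' : s = b
    · subst hsb'
      by_cases htr : t = r
      · subst htr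
        have h₁ := hedge z hz
        have h₂ := hst z (hQS hz) (by rintro rfl; exact hbQ hz) (by rintro rfl; exact hrQ hz)
        rw [det2_swap] at h₂; linarith
      · refine absurd ?_ (hsb t ht htr hct')
        have : S.filter (fun p => 0 < det2 s t p) = (S.erase s).erase t := by
          ext p
          simp only [Finset.mem_filter, Finset.mem_erase]
          constructor
          · rintro ⟨hp, hlt⟩
            refine ⟨?_, ?_, hp⟩ <;> (rintro rfl; simp at hlt)
          · rintro ⟨hpt, hps, hp⟩
            exact ⟨hp, hst p hp hps hpt⟩
        rw [this, wt_erase (Finset.mem_erase.2 ⟨Ne.symm (by rintro rfl; omega), ht⟩), wt_erase hs]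
        omega
    by_cases htr : t = r
    · subst htr
      refine absurd ?_ (hsr s hs hsb' hcs')
      rw [Finset.filter_false_of_mem, wt, Finset.sum_empty]
      intro p hp hlt
      have h₁ : p ≠ s := by rintro rfl; simp at hlt
      have h₂ : p ≠ t := by rintro rfl; simp at hlt
      have := hst p hp h₁ h₂
      rw [det2_swap] at this; linarith
    exact mem_hullArcs.2 ⟨⟨(hmemQ s).2 ⟨hsb', hsr', hs⟩, (hmemQ t).2 ⟨htb, htr, ht⟩⟩, hcs, hct,
      fun p hp => hst p (hQS hp)⟩
  have h₁' := (Finset.card_le_card h₁).trans (Finset.card_insert_le _ _)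
  rw [Finset.card_erase_of_mem huv] at h₁'
  have huv' := Finset.card_pos.2 ⟨_, huv⟩
  have h₂' := Finset.card_le_card h₂
  exact ⟨k', hpath, by omega, by omega⟩

/-- Opposite coloured ends of a hull edge of a balanced set are joined by a good path. -/
lemma good_edge (H : GoodBelow c S.card) (hc : IsCol c) (hS : GenPos S) (hw : wt c S = 0)
    {p q : Pt} (hp : p ∈ S) (hq : q ∈ S) (hpq : c p + c q = 0)
    (h : ∀ x ∈ S, x ≠ p → x ≠ q → 0 < det2 p q x) : Good c S p q := by
  rcases hc p with hcp | hcp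
  · exact H.good_edge_aux hc hS hw hp hq hcp (by omega) h
  · refine good_neg_iff.1 (H.neg.good_edge_aux hc.neg hS ?_ hp hq ?_ ?_ h)
    · rw [wt_neg, hw, neg_zero]
    · rw [Pi.neg_apply, hcp, neg_neg]
    · rw [Pi.neg_apply]; omega

end GoodBelow

/-! ### Equally coloured exposed points -/

lemma Exposed.det2_trans {S : Finset Pt} {r p q s : Pt} (hr : Exposed S r) (hp : p ∈ S) (hq : q ∈ S)
    (hs : s ∈ S) (h₁ : 0 < det2 r q p) (h₂ : 0 < det2 r s q) : 0 < det2 r s p := by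
  obtain ⟨k, hk⟩ := hr.exists_key
  have hpr : p ≠ r := by rintro rfl; simp at h₁
  have hqr : q ≠ r := by rintro rfl; simp at h₁
  have hsr : s ≠ r := by rintro rfl; simp at h₂
  have e₁ := (hk p hp q hq hpr hqr).2 (by rw [det2_swap_right]; linarith)
  have e₂ := (hk q hq s hs hqr hsr).2 (by rw [det2_swap_right]; linarith)
  have := (hk p hp s hs hpr hsr).1 (e₁.trans e₂)
  rw [det2_swap_right]; linarith

/-- The points of `S` preceding `p` in the radial order around `r`. -/
abbrev before (S : Finset Pt) (r p : Pt) : Finset Pt := S.filter fun q => 0 < det2 r p q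

section Before

variable {S : Finset Pt} {r p q : Pt}

lemma mem_before : q ∈ before S r p ↔ q ∈ S ∧ 0 < det2 r p q := Finset.mem_filter

lemma before_subset_erase : before S r p ⊆ S.erase r := by
  intro q hq
  obtain ⟨hq, h⟩ := mem_before.1 hq
  refine Finset.mem_erase.2 ⟨?_, hq⟩
  rintro rfl
  simp at h

lemma Exposed.mem_before_of_lt {s : Pt} (hr : Exposed S r) (hp : p ∈ S) (hs : s ∈ before S r p)
    (hq : q ∈ S) (h : 0 < det2 r s q) : q ∈ before S r p :=
  mem_before.2 ⟨hq, hr.det2_trans hq (mem_before.1 hs).1 hp h (mem_before.1 hs).2⟩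

lemma Exposed.before_subset (hr : Exposed S r) (hp : p ∈ S) (hq : q ∈ before S r p) :
    before S r q ⊆ before S r p := fun _ hs =>
  hr.mem_before_of_lt hp hq (mem_before.1 hs).1 (mem_before.1 hs).2

lemma exists_crossing_before {c : Pt → ℤ} (hc : IsCol c) (hS : GenPos S) (hrS : r ∈ S)
    (hr : Exposed S r) {ℓ : ℤ} {D₁ D₂ : Finset Pt} (hX : D₂ ⊆ S.erase r) (hD : D₁ ⊆ D₂)
    (hl₁ : ∀ p ∈ D₁, ∀ q ∈ S, 0 < det2 r p q → q ∈ D₁)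
    (hl₂ : ∀ p ∈ D₂, ∀ q ∈ S, 0 < det2 r p q → q ∈ D₂) (h₁ : wt c D₁ ≤ ℓ) (h₂ : ℓ < wt c D₂) :
    ∃ β ∈ D₂, β ∉ D₁ ∧ c β = 1 ∧ wt c (before S r β) = ℓ := by
  obtain ⟨β, hβ, hβ', hcβ, hwβ⟩ := exists_crossing hc hS hrS hr (Finset.erase_subset r S)
    (Finset.notMem_erase r S) hX hD (fun p hp q hq => hl₁ p hp q (Finset.mem_of_mem_erase hq))
    (fun p hp q hq => hl₂ p hp q (Finset.mem_of_mem_erase hq)) h₁ h₂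
  refine ⟨β, hβ, hβ', hcβ, ?_⟩
  rw [← hwβ, before]
  congr 1
  ext q
  simp only [Finset.mem_filter, Finset.mem_erase]
  refine ⟨fun h => ⟨⟨?_, h.1⟩, h.2⟩, fun h => ⟨h.1.2, h.2⟩⟩
  rintro rfl
  exact absurd h.2 (by simp)

end Before

namespace GoodBelow

variable {c : Pt → ℤ} {S : Finset Pt} {r r' : Pt}

lemma mono {N M : ℕ} (H : GoodBelow c N) (h : M ≤ N) : GoodBelow c M where
  edge T hT := H.edge T (hT.trans_le h)
  exposed T hT := H.exposed T (hT.trans_le h)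

/-- If no good path joins `r` to `r'`, then for every point `p` coloured like them, the lines
`r p` and `r' p` cannot have balances of different signs. -/
lemma sign_of_not_good (H : GoodBelow c S.card) (hc : IsCol c) (hS : GenPos S) (hr : r ∈ S)
    (hr' : r' ∈ S) (hre : Exposed S r) (hre' : Exposed S r') (hcr : c r = 1) (hcr' : c r' = 1)
    (hw : wt c S = 1) (hbad : ¬ Good c S r r') {p : Pt} (hp : p ∈ S) (hlt : 0 < det2 r r' p)
    (hcp : c p = 1) : (-1 < wt c (before S r p) ∧ 0 < wt c (before S r' p)) ∨
      (wt c (before S r p) < -1 ∧ wt c (before S r' p) < 0) := by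
  have hpr : r ≠ p := by rintro rfl; simp at hlt
  have hpr' : r' ≠ p := by rintro rfl; simp at hlt
  have hno : ∀ a L U, Separates a p L U S → r ∈ L → r' ∈ U → wt c L ≠ 0 := by
    intro a L U h hL hU hwL
    have := h.wt_eq c
    exact hbad (H.good_of_balanced hc hS h hL hre hU hre' hwL (by omega) (by omega) (by omega))
  obtain ⟨a₀, h₀⟩ := exists_separates_pos hS hr hp hpr
  obtain ⟨a₁, h₁⟩ := exists_separates_neg hS hr' hp hpr'
  have hU₀ : r' ∈ S.filter fun q => det2 r p q < 0 :=
    Finset.mem_filter.2 ⟨hr', by rw [det2_swap_right]; linarith⟩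
  have hL₁ : r ∈ before S r' p := mem_before.2 ⟨hr, by rwa [← det2_rotate]⟩
  have hw₀ : wt c (insert r (before S r p)) = 1 + wt c (before S r p) := by
    rw [wt_insert (by simp), hcr]
  have hrot : ¬ (0 ≤ 1 + wt c (before S r p) ∧ wt c (before S r' p) ≤ 0) := fun ⟨e₁, e₂⟩ => by
    obtain ⟨a, L, U, h, hL, hU, hwL⟩ := exists_separates_wt_eq_zero hc hS h₀ h₁.symm
      (Finset.mem_insert_self _ _) hL₁ hU₀ (Finset.mem_insert_self _ _) (hw₀ ▸ e₁) e₂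
    exact hno a L U h hL hU hwL
  have hrot' : ¬ (0 ≤ wt c (before S r' p) ∧ 1 + wt c (before S r p) ≤ 0) := fun ⟨e₁, e₂⟩ => by
    obtain ⟨a, L, U, h, hL, hU, hwL⟩ := exists_separates_wt_eq_zero hc hS h₁.symm h₀
      hL₁ (Finset.mem_insert_self _ _) (Finset.mem_insert_self _ _) hU₀ e₁ (hw₀ ▸ e₂)
    exact hno a L U h hL hU hwL
  omega

lemma good_of_nonneg_left (H : GoodBelow c S.card) (hc : IsCol c) (hS : GenPos S) (hr : r ∈ S)
    (hr' : r' ∈ S) (hre : Exposed S r) (hre' : Exposed S r') (hcr : c r = 1) (hcr' : c r' = 1)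
    (hw : wt c S = 1) (hne : (before S r r').Nonempty) (hleft : 0 ≤ wt c (before S r r')) :
    Good c S r r' := by
  by_contra hbad
  have hsign := fun p hp hlt hcp => H.sign_of_not_good hc hS hr hr' hre hre' hcr hcr' hw hbad
    (p := p) hp hlt hcp
  have hrL : r ∉ before S r r' := by simp
  obtain ⟨p, hp, hfirst⟩ := hre.exists_first (Finset.filter_subset _ _) hrL hS hr hne
  obtain ⟨hpS, hlt⟩ := mem_before.1 hp
  have hp0 : before S r p = ∅ := by
    refine Finset.eq_empty_of_forall_notMem fun q hq => ?_
    have hqL := hre.before_subset hr' hp hq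
    have hlt' := (mem_before.1 hq).2
    exact (hfirst q hqL (by rintro rfl; simp at hlt')).not_gt hlt'
  rcases hc p with hcp | hcp
  · have hG : 0 < wt c (before S r' p) := by
      have := hsign p hpS hlt hcp
      have h0 : wt c (before S r p) = 0 := by rw [hp0, wt, Finset.sum_empty]
      omega
    have hrp : 0 < det2 r' p r := by rwa [← det2_rotate]
    set D := (S.filter fun q => ¬ 0 < det2 r r' q).erase r' with hD
    have hmemD : ∀ q, q ∈ D ↔ q ≠ r' ∧ q ∈ S ∧ ¬ 0 < det2 r r' q := fun q => by
      simp [hD]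
    have hDp : D ⊆ before S r' p := by
      intro q hq
      obtain ⟨hqr', hqS, hq⟩ := (hmemD q).1 hq
      by_cases hqr : q = r
      · subst hqr; exact mem_before.2 ⟨hr, hrp⟩
      · have hrr' : r ≠ r' := by rintro rfl; simp at hlt
        have := hS r hr r' hr' q hqS hrr' (Ne.symm hqr) (Ne.symm hqr')
        have hlt' : det2 r r' q < 0 := lt_of_le_of_ne (not_lt.1 hq) this
        refine mem_before.2 ⟨hqS, hre'.det2_trans hqS hr hpS ?_ hrp⟩
        rw [det2_swap]; linarith
    have hDl : ∀ s ∈ D, ∀ q ∈ S, 0 < det2 r' s q → q ∈ D := by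
      intro s hs q hq hlt'
      obtain ⟨hsr', hsS, hs⟩ := (hmemD s).1 hs
      refine (hmemD q).2 ⟨by rintro rfl; simp at hlt', hq, fun hqL => hs ?_⟩
      have h₁ : 0 < det2 r' q r := by rwa [← det2_rotate]
      have := hre'.det2_trans hr hq hsS h₁ hlt'
      rwa [← det2_rotate] at this
    have hwD : wt c D ≤ 0 := by
      have : wt c (before S r r') + wt c (S.filter fun q => ¬ 0 < det2 r r' q) = wt c S :=
        Finset.sum_filter_add_sum_filter_not S _ c
      rw [hD, wt_erase (Finset.mem_filter.2 ⟨hr', by simp⟩)]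
      omega
    obtain ⟨β, hβ, hβD, hcβ, hwβ⟩ := exists_crossing_before hc hS hr' hre' before_subset_erase hDp
      hDl (fun s hs q hq h => hre'.mem_before_of_lt hpS hs hq h) hwD hG
    obtain ⟨hβS, hβp⟩ := mem_before.1 hβ
    have hβL : 0 < det2 r r' β := by
      by_contra h
      exact hβD ((hmemD β).2 ⟨by rintro rfl; simp at hβp, hβS, h⟩)
    have := hsign β hβS hβL hcβ
    omega
  · have hl : ∀ s ∈ ({p} : Finset Pt), ∀ q ∈ S, 0 < det2 r s q → q ∈ ({p} : Finset Pt) := by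
      intro s hs q hq hlt'
      rw [Finset.mem_singleton] at hs
      subst hs
      have := mem_before.2 ⟨hq, hlt'⟩
      rw [hp0] at this
      simp at this
    obtain ⟨β, hβ, -, hcβ, hwβ⟩ := exists_crossing_before hc hS hr hre (ℓ := -1) (D₁ := {p})
      before_subset_erase (by simpa using hp) hl
      (fun s hs q hq h => hre.mem_before_of_lt hr' hs hq h) (by simp [wt, hcp]) (by omega)
    have := hsign β (mem_before.1 hβ).1 (mem_before.1 hβ).2 hcβ
    omega

end GoodBelow

namespace GoodBelow

variable {c : Pt → ℤ} {S : Finset Pt} {r r' : Pt}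

lemma good_of_hull_edge (H : GoodBelow c S.card) (hc : IsCol c) (hS : GenPos S) (hr : r ∈ S)
    (hr' : r' ∈ S) (hne : r ≠ r') (hcr : c r = 1) (hcr' : c r' = 1) (hw : wt c S = 1)
    (hfull : ∀ p ∈ S, p ≠ r → p ≠ r' → 0 < det2 r r' p) : Good c S r r' := by
  by_contra hbad
  have hre := exposed_of_edge hne hfull
  have hre' := exposed_of_edge' hne hfull
  have hsign := fun p hp hlt hcp => H.sign_of_not_good hc hS hr hr' hre hre' hcr hcr' hw hbad
    (p := p) hp hlt hcp
  have hleft : before S r r' = (S.erase r).erase r' := by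
    ext p
    rw [mem_before, Finset.mem_erase, Finset.mem_erase]
    refine ⟨fun h => ⟨?_, ?_, h.1⟩, fun h => ⟨h.2.2, hfull p h.2.2 h.2.1 h.1⟩⟩ <;>
    · rintro rfl
      exact absurd h.2 (by simp)
  have hwleft : wt c (before S r r') = -1 := by
    rw [hleft, wt_erase (Finset.mem_erase.2 ⟨hne.symm, hr'⟩), wt_erase hr]
    omega
  -- the first blue point that is balanced as seen from `r`
  set Y := (before S r r').filter fun p => c p = -1 ∧ wt c (before S r p) = 0 with hY
  have hYne : ∀ q ∈ S, before S r q ⊆ before S r r' → wt c (before S r q) < 0 →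
      ∃ β ∈ before S r q, β ∈ Y := by
    intro q hq hsub hlt
    obtain ⟨β, hβ, -, hcβ, hwβ⟩ := exists_crossing_before hc.neg hS hr hre (ℓ := 0) (D₁ := ∅)
      before_subset_erase (Finset.empty_subset _) (by simp)
      (fun s hs p hp h => hre.mem_before_of_lt hq hs hp h) (by simp [wt])
      (by rw [wt_neg]; omega)
    rw [Pi.neg_apply] at hcβ
    rw [wt_neg] at hwβ
    exact ⟨β, hβ, Finset.mem_filter.2 ⟨hsub hβ, by omega, by omega⟩⟩
  have hYS : Y ⊆ S := (Finset.filter_subset _ _).trans (Finset.filter_subset _ _)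
  have hrY : r ∉ Y := fun h => by
    have := (Finset.mem_filter.1 h).2.1
    omega
  obtain ⟨b, hbY, hbfirst⟩ := hre.exists_first hYS hrY hS hr (by
    obtain ⟨β, -, hβ⟩ := hYne r' hr' (Finset.Subset.refl _) (by omega)
    exact ⟨β, hβ⟩)
  obtain ⟨hbleft, hcb, hwb⟩ := Finset.mem_filter.1 hbY
  obtain ⟨hbS, hblt⟩ := mem_before.1 hbleft
  have hbefore : ∀ p ∈ before S r b, 0 ≤ wt c (before S r p) := by
    intro p hp
    by_contra! hlt
    have hsub := hre.before_subset hbS hp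
    obtain ⟨β, hβ, hβY⟩ := hYne p (mem_before.1 hp).1
      (hsub.trans (hre.before_subset hr' hbleft)) hlt
    have hβlt := (mem_before.1 (hsub hβ)).2
    exact (hbfirst β hβY (by rintro rfl; simp at hβlt)).not_gt hβlt
  have hrb : r ≠ b := by rintro rfl; omega
  have hrb' : r' ≠ b := by rintro rfl; omega
  set U := S.filter fun p => det2 r b p < 0 with hU
  obtain ⟨a, ha⟩ : ∃ a, Separates a b (insert r (before S r b)) U S :=
    exists_separates_pos hS hr hbS hrb
  have hr'U : r' ∈ U := Finset.mem_filter.2 ⟨hr', by rw [det2_swap_right]; linarith⟩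
  have hwL : wt c (insert r (before S r b)) = 1 := by rw [wt_insert (by simp), hcr, hwb, add_zero]
  have hwU : wt c U = 1 := by
    have := ha.wt_eq c
    omega
  have hcard := ha.card_eq
  have hL0 : 0 < (insert r (before S r b)).card := Finset.card_pos.2 ⟨r, by simp⟩
  have hU0 := Finset.card_pos.2 ⟨_, hr'U⟩
  have hTS : insert b U ⊆ S := ha.high_subset
  have hTgp := hS.mono hTS
  have hbU := ha.notMem_high
  have hTcard : (insert b U).card < S.card := by rw [Finset.card_insert_of_notMem hbU]; omega
  have hr'T : r' ∈ insert b U := Finset.mem_insert_of_mem hr'U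
  have hbT : b ∈ insert b U := Finset.mem_insert_self _ _
  have hwT : wt c (insert b U) = 0 := by rw [wt_insert hbU]; omega
  have hT : ¬ Good c (insert b U) b r' := fun hgood => by
    refine hbad (ha.good_of_bridge hc hS ?_ hgood (Finset.mem_insert_self _ _) hr'U (by omega)
      (by omega) hfull)
    refine H.edge _ ?_ (hS.mono ha.low_subset) ?_ r (by simp) b (by simp) (by omega) ?_
    · rw [Finset.card_insert_of_notMem ha.notMem_low]; omega
    · rw [wt_insert ha.notMem_low]; omega
    · intro x hx hxr hxb
      exact (mem_before.1 (Finset.mem_of_mem_insert_of_ne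
        (Finset.mem_of_mem_insert_of_ne hx hxb) hxr)).2
  obtain ⟨β, hβ, -, hcβ, hwβ⟩ := exists_crossing_before hc.neg hTgp hr'T (hre'.mono hTS) (ℓ := 0)
    (D₁ := ∅) (D₂ := (insert b U).erase r') (Finset.Subset.refl _) (Finset.empty_subset _) (by simp)
    (fun s _ q hq h => Finset.mem_erase.2 ⟨by rintro rfl; simp at h, hq⟩) (by simp [wt])
    (by rw [wt_neg, wt_erase hr'T]; omega)
  rw [wt_neg, neg_eq_zero] at hwβ
  rw [Pi.neg_apply] at hcβ
  obtain rfl : β = b := by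
    by_contra hβb
    exact hT ((H.mono hTcard.le).good_of_split hc hTgp hwT hr'T hbT (Finset.mem_of_mem_erase hβ)
      ha.exposed_high (by omega) hβb (by omega) hwβ).reverse
  have hTne : (before (insert β U) r' β).Nonempty := by
    by_contra hempty
    rw [Finset.not_nonempty_iff_eq_empty] at hempty
    refine hT (H.edge _ hTcard hTgp hwT β hbT r' hr'T (by omega) fun x hx hxβ hxr' => ?_)
    have h₁ := hTgp r' hr'T β hbT x hx hrb' (Ne.symm hxr') (Ne.symm hxβ)
    have h₂ : ¬ 0 < det2 r' β x := fun h => by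
      have := mem_before.2 ⟨hx, h⟩
      rw [hempty] at this
      simp at this
    rw [det2_swap]
    exact neg_pos.2 (lt_of_le_of_ne (not_lt.1 h₂) h₁)
  -- a red point after `β` as seen from `r` and before `β` as seen from `r'`
  obtain ⟨x, hx, hcx⟩ : ∃ x ∈ before (insert β U) r' β, c x = 1 := by
    obtain ⟨y, hy⟩ := hTne
    rcases hc y with hcy | hcy
    · exact ⟨y, hy, hcy⟩
    · obtain ⟨x, hx, hcx⟩ := exists_mem_of_wt_pos hc (S := (before (insert β U) r' β).erase y)
        (by rw [wt_erase hy]; omega)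
      exact ⟨x, Finset.mem_of_mem_erase hx, hcx⟩
  obtain ⟨hxT, hβx⟩ := mem_before.1 hx
  have hxS := hTS hxT
  have hxβ : x ≠ β := by rintro rfl; omega
  have hxlt : 0 < det2 r x β := by
    have := (Finset.mem_filter.1 (Finset.mem_of_mem_insert_of_ne hxT hxβ)).2
    rw [det2_swap_right]; linarith
  have hxr : x ≠ r := by rintro rfl; simp at hxlt
  have hxr' : x ≠ r' := by rintro rfl; simp at hβx
  have hxleft := hfull x hxS hxr hxr'
  have hxneg : wt c (before S r' x) < 0 := by
    rcases hsign x hxS hxleft hcx with ⟨h, -⟩ | ⟨-, h⟩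
    · exfalso
      have hβx' : β ∈ before S r x := mem_before.2 ⟨hbS, hxlt⟩
      obtain ⟨y, hy, -, hcy, hwy⟩ := exists_crossing_before hc hS hr hre (ℓ := -1)
        (D₁ := insert β (before S r β)) (D₂ := before S r x) before_subset_erase
        (Finset.insert_subset hβx' (hre.before_subset hxS hβx')) (by
          intro s hs q hq hlt
          refine Finset.mem_insert_of_mem ?_
          rcases Finset.mem_insert.1 hs with rfl | hs
          · exact mem_before.2 ⟨hq, hlt⟩
          · exact hre.mem_before_of_lt hbS hs hq hlt)
        (fun s hs q hq h => hre.mem_before_of_lt hxS hs hq h)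
        (by rw [wt_insert (by simp), hwb]; omega) h
      have := hsign y (mem_before.1 hy).1 (mem_before.1 (hre.before_subset hr'
        (mem_before.2 ⟨hxS, hxleft⟩) hy)).2 hcy
      omega
    · exact h
  have hrx : r ∈ before S r' x := mem_before.2 ⟨hr, by rwa [← det2_rotate]⟩
  have hup : ∀ y ∈ S, x ∈ before S r' y → wt c (before S r' y) ≤ 0 := by
    intro y hy hxy
    by_contra! hlt
    obtain ⟨z, hz, hzx, hcz, hwz⟩ := exists_crossing_before hc hS hr' hre' before_subset_erase
      (hre'.before_subset hy hxy) (fun s hs q hq h => hre'.mem_before_of_lt hxS hs hq h)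
      (fun s hs q hq h => hre'.mem_before_of_lt hy hs hq h) hxneg.le hlt
    obtain ⟨hzr', hzS⟩ := Finset.mem_erase.1 (before_subset_erase hz)
    have := hsign z hzS (hfull z hzS (by rintro rfl; exact hzx hrx) hzr') hcz
    omega
  have hβneg := hup β hbS (mem_before.2 ⟨hxS, hβx⟩)
  -- a red point before `β` as seen from `r` and after `β` as seen from `r'`
  have hsplit : wt c (before S r' β) =
      1 + wt c ((before S r β).filter fun p => 0 < det2 r' β p) +
        wt c (before (insert β U) r' β) := by
    have hrβ : 0 < det2 r' β r := hre'.det2_trans hr hxS hbS (mem_before.1 hrx).2 hβx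
    have e : insert r (before S r β) ∪ insert β U = S := by
      rw [Finset.union_insert]; exact ha.eq.symm
    have hd : Disjoint (insert r (before S r β)) (insert β U) :=
      Finset.disjoint_insert_right.2 ⟨ha.notMem_low, ha.disjoint⟩
    have e' : before S r' β = (insert r (before S r β)).filter (fun p => 0 < det2 r' β p)
        ∪ before (insert β U) r' β := by
      rw [← Finset.filter_union, e]
    rw [e', wt_union (Finset.disjoint_filter_filter hd), Finset.filter_insert, if_pos hrβ,
      wt_insert (by simp), hcr]
  obtain ⟨y, hy, hcy⟩ : ∃ y ∈ (before S r β).filter fun p => ¬ 0 < det2 r' β p, c y = 1 := by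
    refine exists_mem_of_wt_pos hc ?_
    have : wt c ((before S r β).filter fun p => 0 < det2 r' β p)
        + wt c ((before S r β).filter fun p => ¬ 0 < det2 r' β p) = wt c (before S r β) :=
      Finset.sum_filter_add_sum_filter_not _ _ c
    omega
  obtain ⟨hyβ, hylt⟩ := Finset.mem_filter.1 hy
  obtain ⟨hyS, hβy⟩ := mem_before.1 hyβ
  have hyr' : y ≠ r' := by rintro rfl; linarith [(Finset.mem_filter.1 hr'U).2]
  have hyβ' : y ≠ β := by rintro rfl; simp at hβy
  have hyr : y ≠ r := by rintro rfl; simp at hβy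
  have hβy' : β ∈ before S r' y := by
    have := hS r' hr' β hbS y hyS hrb' (Ne.symm hyr') (Ne.symm hyβ')
    refine mem_before.2 ⟨hbS, ?_⟩
    rw [det2_swap_right]
    exact neg_pos.2 (lt_of_le_of_ne (not_lt.1 hylt) this)
  have h₁ := hbefore y hyβ
  have h₂ := hup y hyS (hre'.before_subset hyS hβy' (mem_before.2 ⟨hxS, hβx⟩))
  have h₃ := hsign y hyS (hfull y hyS hyr hyr') hcy
  omega

end GoodBelow

namespace GoodBelow

variable {c : Pt → ℤ} {S : Finset Pt} {r r' : Pt}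

lemma good_exposed_aux (H : GoodBelow c S.card) (hc : IsCol c) (hS : GenPos S) (hr : r ∈ S)
    (hr' : r' ∈ S) (hne : r ≠ r') (hre : Exposed S r) (hre' : Exposed S r') (hcr : c r = 1)
    (hcr' : c r' = 1) (hw : wt c S = 1) : Good c S r r' := by
  have hrest : wt c (before S r r') + wt c (before S r' r) = -1 := by
    have hd : Disjoint (before S r r') (before S r' r) := Finset.disjoint_left.2 fun p hp hp' => by
      have h₁ := (mem_before.1 hp).2
      have h₂ := (mem_before.1 hp').2
      rw [det2_swap] at h₂; linarith
    rw [← wt_union hd]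
    have : before S r r' ∪ before S r' r = (S.erase r).erase r' := by
      ext p
      rw [Finset.mem_union, mem_before, mem_before, Finset.mem_erase, Finset.mem_erase]
      constructor
      · rintro (h | h) <;> refine ⟨?_, ?_, h.1⟩ <;>
        · rintro rfl
          exact absurd h.2 (by simp)
      · rintro ⟨h₁, h₂, h₃⟩
        rcases lt_or_gt_of_ne (hS r hr r' hr' p h₃ hne (Ne.symm h₂) (Ne.symm h₁)) with h | h
        · exact .inr ⟨h₃, by rw [det2_swap]; linarith⟩
        · exact .inl ⟨h₃, h⟩
    rw [this, wt_erase (Finset.mem_erase.2 ⟨hne.symm, hr'⟩), wt_erase hr]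
    omega
  have hfull : ∀ {x y : Pt}, x ∈ S → y ∈ S → x ≠ y → before S y x = ∅ →
      ∀ p ∈ S, p ≠ x → p ≠ y → 0 < det2 x y p := by
    intro x y hx hy hxy h p hp hpx hpy
    refine lt_of_le_of_ne (not_lt.1 fun hlt => ?_)
      (hS x hx y hy p hp hxy (Ne.symm hpx) (Ne.symm hpy)).symm
    have := mem_before.2 ⟨hp, show 0 < det2 y x p by rw [det2_swap]; linarith⟩
    rw [h] at this
    simp at this
  rcases (before S r' r).eq_empty_or_nonempty with h₁ | h₁
  · exact H.good_of_hull_edge hc hS hr hr' hne hcr hcr' hw (hfull hr hr' hne h₁)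
  rcases (before S r r').eq_empty_or_nonempty with h₂ | h₂
  · exact (H.good_of_hull_edge hc hS hr' hr hne.symm hcr' hcr hw (hfull hr' hr hne.symm h₂)).reverse
  rcases le_or_gt 0 (wt c (before S r r')) with h₃ | h₃
  · exact H.good_of_nonneg_left hc hS hr hr' hre hre' hcr hcr' hw h₂ h₃
  · exact (H.good_of_nonneg_left hc hS hr' hr hre' hre hcr' hcr hw h₁ (by omega)).reverse

/-- Two exposed points of the majority colour of a set with excess one are joined by a good path. -/
lemma good_exposed (H : GoodBelow c S.card) (hc : IsCol c) (hS : GenPos S) (hr : r ∈ S)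
    (hr' : r' ∈ S) (hne : r ≠ r') (hre : Exposed S r) (hre' : Exposed S r') (hw : wt c S = c r)
    (hrr' : c r' = c r) : Good c S r r' := by
  rcases hc r with hcr | hcr
  · exact H.good_exposed_aux hc hS hr hr' hne hre hre' hcr (by omega) (by omega)
  · refine good_neg_iff.1 (H.neg.good_exposed_aux hc.neg hS hr hr' hne hre hre' ?_ ?_ ?_)
    · rw [Pi.neg_apply]; omega
    · rw [Pi.neg_apply]; omega
    · rw [wt_neg]; omega

end GoodBelow

theorem goodBelow {c : Pt → ℤ} (hc : IsCol c) (N : ℕ) : GoodBelow c N := by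
  induction N with
  | zero =>
    exact ⟨fun T hT => absurd hT (Nat.not_lt_zero _), fun T hT => absurd hT (Nat.not_lt_zero _)⟩
  | succ N ih =>
    refine ⟨fun T hT hgp hw p hp q hq hpq h => ?_, fun T hT hgp p hp q hq hne hpe hqe hw hpq => ?_⟩
    · exact (ih.mono (Nat.lt_succ_iff.1 hT)).good_edge hc hgp hw hp hq hpq h
    · exact (ih.mono (Nat.lt_succ_iff.1 hT)).good_exposed hc hgp hp hq hne hpe hqe hw hpq

/-! ### Convex hulls and the main theorem -/

lemma collinear_of_det2_eq_zero {p q r : Pt} (hpq : p ≠ q) (h : det2 p q r = 0) :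
    Collinear ℝ ({p, q, r} : Set Pt) := by
  have key : ∃ t : ℝ, r = t • (q - p) + p := by
    simp only [det2] at h
    by_cases h₁ : q.1 - p.1 = 0
    · have h₂ : q.2 - p.2 ≠ 0 := fun h₂ =>
        hpq (Prod.ext (sub_eq_zero.1 h₁).symm (sub_eq_zero.1 h₂).symm)
      refine ⟨(r.2 - p.2) / (q.2 - p.2), Prod.ext ?_ ?_⟩ <;>
        simp only [Prod.fst_add, Prod.snd_add, Prod.smul_fst, Prod.smul_snd, Prod.fst_sub,
          Prod.snd_sub, smul_eq_mul] <;> field_simp <;> linarith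
    · refine ⟨(r.1 - p.1) / (q.1 - p.1), Prod.ext ?_ ?_⟩ <;>
        simp only [Prod.fst_add, Prod.snd_add, Prod.smul_fst, Prod.smul_snd, Prod.fst_sub,
          Prod.snd_sub, smul_eq_mul] <;> field_simp <;> linarith
  obtain ⟨t, ht⟩ := key
  refine (collinear_iff_of_mem (p₀ := p) (by simp)).2 ⟨q - p, fun x hx => ?_⟩
  rcases hx with rfl | rfl | rfl
  · exact ⟨0, by simp⟩
  · exact ⟨1, by simp⟩
  · exact ⟨t, ht⟩

lemma GeneralPosition.genPos {S : Finset Pt} (h : GeneralPosition S) : GenPos S :=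
  fun p hp q hq r hr hpq hpr hqr h0 => h p hp q hq r hr hpq hpr hqr
    (collinear_of_det2_eq_zero hpq h0)

lemma exposed_of_mem_hullPts {S : Finset Pt} {p : Pt} (h : p ∈ hullPts S) : Exposed S p := by
  obtain ⟨f, u, hp, hu⟩ := geometric_hahn_banach_point_closed (convex_convexHull ℝ _)
    ((Finset.finite_toSet (S.erase p)).isClosed_convexHull ℝ) (Finset.mem_filter.1 h).2
  have hf : ∀ x : Pt, dot (f (1, 0), f (0, 1)) x = f x := fun x => by
    have : x = x.1 • ((1, 0) : Pt) + x.2 • ((0, 1) : Pt) := by ext <;> simp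
    conv_rhs => rw [this, map_add, map_smul, map_smul]
    simp only [dot, smul_eq_mul]
    ring
  refine ⟨(f (1, 0), f (0, 1)), fun q hq hqp => ?_⟩
  rw [hf, hf]
  exact hp.trans (hu q (subset_convexHull ℝ _ (Finset.mem_coe.2 (Finset.mem_erase.2 ⟨hqp, hq⟩))))

lemma subset_convexHull_hullPts (S : Finset Pt) :
    (S : Set Pt) ⊆ convexHull ℝ (hullPts S : Set Pt) := by
  have hext : (convexHull ℝ (S : Set Pt)).extremePoints ℝ ⊆ hullPts S := by
    intro p hp
    refine Finset.mem_filter.2 ⟨extremePoints_convexHull_subset hp, fun h => ?_⟩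
    have hconv := ((convex_convexHull ℝ _).mem_extremePoints_iff_convex_sdiff.1 hp).2
    refine (convexHull_min ?_ hconv h).2 rfl
    intro q hq
    obtain ⟨hqp, hq⟩ := Finset.mem_erase.1 hq
    exact ⟨subset_convexHull ℝ _ hq, hqp⟩
  have hcl : IsClosed (convexHull ℝ (hullPts S : Set Pt)) :=
    (Finset.finite_toSet _).isClosed_convexHull ℝ
  calc (S : Set Pt) ⊆ convexHull ℝ (S : Set Pt) := subset_convexHull ℝ _
    _ = closure (convexHull ℝ ((convexHull ℝ (S : Set Pt)).extremePoints ℝ)) :=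
      (closure_convexHull_extremePoints ((Finset.finite_toSet S).isCompact_convexHull ℝ)
        (convex_convexHull ℝ _)).symm
    _ ⊆ convexHull ℝ (hullPts S : Set Pt) := closure_minimal (convexHull_mono hext) hcl

lemma convex_setOf_det2_nonneg (p q : Pt) : Convex ℝ {x | 0 ≤ det2 p q x} := by
  intro x hx y hy s t hs ht hst
  have : det2 p q (s • x + t • y) = s * det2 p q x + t * det2 p q y := by
    obtain rfl : s = 1 - t := by linarith
    simp only [det2, Prod.fst_add, Prod.snd_add, Prod.smul_fst, Prod.smul_snd, smul_eq_mul]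
    ring
  rw [Set.mem_ofPred_eq, this]
  exact add_nonneg (mul_nonneg hs hx) (mul_nonneg ht hy)

lemma CWList.det2_cycPred_nonneg {m : ℕ} (hm : 0 < m) {pt : Fin m → Pt} (h : CWList pt)
    (i j : Fin m) : 0 ≤ det2 (pt i) (pt (cycPred hm i)) (pt j) := by
  by_cases hji : j = i
  · rw [hji, det2_left_eq]
  by_cases hjp : j = cycPred hm i
  · rw [hjp, det2_right_eq]
  have hi := i.isLt
  have hj := j.isLt
  have hji' : j.val ≠ i.val := fun e => hji (Fin.ext e)
  have hjp' : j.val ≠ (cycPred hm i).val := fun e => hjp (Fin.ext e)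
  rcases Nat.eq_zero_or_pos i.val with h0 | h0
  · have hp : (cycPred hm i).val = m - 1 := by
      simp only [cycPred, h0, zero_add]
      exact Nat.mod_eq_of_lt (by omega)
    have := h.2 i j (cycPred hm i) (Fin.lt_def.2 (by omega)) (Fin.lt_def.2 (by omega))
    rw [det2_swap_right]; linarith
  · have hp : (cycPred hm i).val = i.val - 1 := by
      simp only [cycPred]
      rw [show i.val + (m - 1) = i.val - 1 + m by omega, Nat.add_mod_right]
      exact Nat.mod_eq_of_lt (by omega)
    rcases lt_or_gt_of_ne hji' with hlt | hlt
    · have := h.2 j (cycPred hm i) i (Fin.lt_def.2 (by omega)) (Fin.lt_def.2 (by omega))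
      rw [det2_swap, ← det2_rotate]; linarith
    · have := h.2 (cycPred hm i) i j (Fin.lt_def.2 (by omega)) (Fin.lt_def.2 (by omega))
      rw [det2_swap]; linarith

lemma IsHullList.det2_cycPred_pos {S : Finset Pt} (hS : GenPos S) {m : ℕ} (hm : 0 < m)
    {pt : Fin m → Pt} (h : IsHullList S pt) {i : Fin m} (hne : pt i ≠ pt (cycPred hm i)) {p : Pt}
    (hp : p ∈ S) (hpi : p ≠ pt i) (hpp : p ≠ pt (cycPred hm i)) :
    0 < det2 (pt i) (pt (cycPred hm i)) p := by
  have hmem : ∀ j, pt j ∈ S := fun j => by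
    have : pt j ∈ hullPts S := h.2 ▸ Finset.mem_image_of_mem _ (Finset.mem_univ j)
    exact (Finset.mem_filter.1 this).1
  refine lt_of_le_of_ne ?_ (hS _ (hmem _) _ (hmem _) p hp hne hpi.symm hpp.symm).symm
  refine convexHull_min ?_ (convex_setOf_det2_nonneg _ _) (subset_convexHull_hullPts S hp)
  intro q hq
  rw [← h.2] at hq
  obtain ⟨j, -, rfl⟩ := Finset.mem_image.1 hq
  exact h.1.det2_cycPred_nonneg hm i j

/-- The colouring of the plane with the points of `R` coloured `1`. -/
def colour (R : Finset Pt) (p : Pt) : ℤ := if p ∈ R then 1 else -1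

lemma isCol_colour (R : Finset Pt) : IsCol (colour R) := fun p => by
  simp only [colour]
  split <;> simp

lemma colour_eq_one {R : Finset Pt} {p : Pt} (h : p ∈ R) : colour R p = 1 := if_pos h

lemma colour_eq_neg_one {R : Finset Pt} {p : Pt} (h : p ∉ R) : colour R p = -1 := if_neg h

lemma wt_colour {R B : Finset Pt} (h : Disjoint R B) :
    wt (colour R) (R ∪ B) = R.card - B.card := by
  have h₁ : wt (colour R) R = R.card := by
    rw [wt, Finset.sum_congr rfl fun p hp => colour_eq_one hp]
    simp
  have h₂ : wt (colour R) B = -B.card := by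
    rw [wt, Finset.sum_congr rfl fun p hp => colour_eq_neg_one (Finset.disjoint_right.1 h hp)]
    simp
  rw [wt_union h, h₁, h₂]
  ring

lemma runCount_le_card_hullArcs {R B : Finset Pt} (hdisj : Disjoint R B) (hS : GenPos (R ∪ B))
    {m : ℕ} (hm : 0 < m) {pt : Fin m → Pt} (h : IsHullList (R ∪ B) pt) {r : Pt} (hr : r ∈ R)
    (hrh : r ∈ hullPts (R ∪ B)) :
    runCount hm B R pt ≤ (hullArcs (-colour R) (R ∪ B)).card := by
  have hall : ¬ ∀ i, pt i ∈ B := fun hB => by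
    rw [← h.2] at hrh
    obtain ⟨i, -, rfl⟩ := Finset.mem_image.1 hrh
    exact Finset.disjoint_left.1 hdisj hr (hB i)
  rw [runCount, if_neg hall]
  refine Finset.card_le_card_of_injOn (fun i => (pt i, pt (cycPred hm i))) (fun i hi => ?_)
    fun i _ j _ hij => h.1.1 (Prod.mk.inj hij).1
  obtain ⟨hiB, hiR⟩ := (Finset.mem_filter.1 hi).2
  have hiR' := Finset.disjoint_right.1 hdisj hiB
  refine mem_hullArcs.2 ⟨⟨Finset.mem_union_right _ hiB, Finset.mem_union_left _ hiR⟩, ?_, ?_,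
    fun p hp hpi hpp => h.det2_cycPred_pos hS hm (fun e => hiR' (e ▸ hiR)) hp hpi hpp⟩
  · rw [Pi.neg_apply, colour_eq_neg_one hiR', neg_neg]
  · rw [Pi.neg_apply, colour_eq_one hiR]

/-- Lemma 2.4(ii): for `S = R ∪ B` in general position with `|R| = |B| + 1 = n + 1 ≥ 2`,
a red point `r` on the hull boundary and another red point `r' ≠ r` on the hull boundary,
there exists a 1-plane Hamiltonian alternating path on `S` with endpoints `r` and `r'`
and at most `n − b(S)` crossings. -/
theorem stmt4 (n : ℕ) (hn : 1 ≤ n) (R B : Finset Pt)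
    (hdisj : Disjoint R B)
    (hgp : GeneralPosition (R ∪ B))
    (hR : R.card = n + 1) (hB : B.card = n)
    (r r' : Pt) (hr : r ∈ R) (hrh : r ∈ hullPts (R ∪ B))
    (hr' : r' ∈ R) (hne : r' ≠ r) (hrh' : r' ∈ hullPts (R ∪ B)) :
    ∃ P : HamAltPath R B r r',
      OnePlane (pathEdges P.verts) ∧
      ∀ (m : ℕ) (hm : 0 < m) (pt : Fin m → Pt), IsHullList (R ∪ B) pt →
        crossNum (pathEdges P.verts) ≤ n - runCount hm B R pt := by
  have hS := hgp.genPos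
  have hcard : (R ∪ B).card = 2 * n + 1 := by
    rw [Finset.card_union_of_disjoint hdisj]; omega
  have hw : wt (colour R) (R ∪ B) = 1 := by
    rw [wt_colour hdisj, hR, hB]; push_cast; ring
  obtain ⟨k, ⟨l, hnodup, hcover, hhead, hlast, halt, hdeg, hk⟩, -, hbound⟩ :=
    (goodBelow (isCol_colour R) ((R ∪ B).card + 1)).exposed _ (Nat.lt_succ_self _) hS r
      (Finset.mem_union_left _ hr) r' (Finset.mem_union_left _ hr') hne.symm
      (exposed_of_mem_hullPts hrh) (exposed_of_mem_hullPts hrh')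
      (by rw [hw, colour_eq_one hr]) (by rw [colour_eq_one hr, colour_eq_one hr'])
  refine ⟨⟨l, hnodup, hcover, hhead, hlast, fun e he => ?_⟩, onePlane_of_crossDegree_le hdeg,
    fun m hm pt hpt => ?_⟩
  · have hmem : ∀ p ∈ l, p ∈ R ∨ p ∈ B := fun p hp =>
      Finset.mem_union.1 (hcover ▸ List.mem_toFinset.2 hp)
    have hsum := halt e he
    obtain ⟨h₁, h₂⟩ := mem_of_mem_pathEdges he
    by_cases hR₁ : e.1 ∈ R <;> by_cases hR₂ : e.2 ∈ R
    · rw [colour_eq_one hR₁, colour_eq_one hR₂] at hsum; omega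
    · exact .inl ⟨hR₁, (hmem _ h₂).resolve_left hR₂⟩
    · exact .inr ⟨(hmem _ h₁).resolve_left hR₁, hR₂⟩
    · rw [colour_eq_neg_one hR₁, colour_eq_neg_one hR₂] at hsum; omega
  · have := runCount_le_card_hullArcs hdisj hS hm hpt hr hrh
    rw [crossNum_eq_numCross, hk]
    omega

end
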